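/- arXiv:1902.04831 — 3 statements merged into one kernel-verified Lean document; each statement's English description precedes it below -/
import Mathlib

section
/- Let R be a commutative ring, A an R-algebra of finite expansion, and let R' be the integral closure of R in A. Then the set qIsol(A/R) of primes of A that are quasi-isolated in their fibre over Spec R coincides with the set LocIsom(A/R') of primes q of A for which there exists s ∈ R' with s ∉ q such that the canonical map of localizations (R')_s → A_s is an isomorphism. In particular, qIsol(A/R) is an open subset of Spec A. -/
open TensorProduct

/-- An `R`-algebra `A` is of *finite expansion* if it is integral over a finitely
generated subalgebra, i.e. there is a finite set of quasi-generators. -/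
def Algebra.FiniteExpansion (R A : Type*) [CommRing R] [CommRing A] [Algebra R A] : Prop :=
  ∃ s : Finset A, Algebra.IsIntegral (Algebra.adjoin R (s : Set A)) A

/-- The fibre ring `A ⊗_R κ(p)` of `Spec A → Spec R` over a prime `p` of `R`, where
`κ(p) = Frac(R ⧸ p)` is the residue field at `p`. -/
abbrev fiberRing (R A : Type*) [CommRing R] [CommRing A] [Algebra R A] (p : Ideal R) :
    Type _ :=
  A ⊗[R] FractionRing (R ⧸ p)

/-- A prime `q` of `A` is *quasi-isolated in its fibre* over `Spec R` if the connected
component of the corresponding point of the fibre `Spec (A ⊗_R κ(p))`, where `p = q ∩ R`,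
is a singleton. -/
def QuasiIsolatedInFiber (R : Type*) {A : Type*} [CommRing R] [CommRing A] [Algebra R A]
    (q : PrimeSpectrum A) : Prop :=
  ∀ q' : PrimeSpectrum (fiberRing R A (q.asIdeal.comap (algebraMap R A))),
    PrimeSpectrum.comap Algebra.TensorProduct.includeLeftRingHom q' = q →
      connectedComponent q' = {q'}

lemma Homeomorph.connectedComponent_eq_singleton_iff {X Y : Type*} [TopologicalSpace X]
    [TopologicalSpace Y] (e : X ≃ₜ Y) (x : X) :
    connectedComponent (e x) = {e x} ↔ connectedComponent x = {x} := by
  have h := Homeomorph.image_connectedComponentIn e (Set.mem_univ x)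
  rw [Set.image_univ, e.surjective.range_eq, connectedComponentIn_univ,
    connectedComponentIn_univ] at h
  rw [← h, ← Set.image_singleton, e.injective.image_injective.eq_iff]

namespace PrimeSpectrum

lemma mem_iff_mem_of_mem_connectedComponent {K F : Type*} [Field K] [CommRing F] [Algebra K F]
    {x y : PrimeSpectrum F} (hy : y ∈ connectedComponent x) {t : F} (ht : IsIntegral K t) :
    t ∈ x.asIdeal ↔ t ∈ y.asIdeal := by
  let E := Algebra.adjoin K {t}
  have : Module.Finite K E := Module.Finite.iff_fg.mpr ht.fg_adjoin_singleton
  have : IsArtinianRing E := .of_finite K E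
  have h := (isPreconnected_connectedComponent (x := x)).image
    (comap (algebraMap E F)) (continuous_comap _).continuousOn
  have heq := h.subsingleton ⟨x, mem_connectedComponent, rfl⟩ ⟨y, hy, rfl⟩
  let t' : E := ⟨t, Algebra.self_mem_adjoin_singleton K t⟩
  exact congr(t' ∈ ($heq).asIdeal).to_iff

lemma connectedComponent_eq_singleton_of_isIntegral_pow_mul {K F : Type*} [Field K] [CommRing F]
    [Algebra K F] (x : PrimeSpectrum F) (s : F) (hsx : s ∉ x.asIdeal) (hs : IsIntegral K s)
    (H : ∀ t, ∃ m, IsIntegral K (s ^ m * t)) : connectedComponent x = {x} := by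
  refine Set.eq_singleton_iff_unique_mem.mpr ⟨mem_connectedComponent, fun y hy ↦ ?_⟩
  have hsy := (mem_iff_mem_of_mem_connectedComponent hy hs).not.mp hsx
  ext t
  obtain ⟨m, hm⟩ := H t
  have := mem_iff_mem_of_mem_connectedComponent hy hm
  rwa [Ideal.IsPrime.mul_mem_left_iff (mt (x.isPrime.mem_of_pow_mem m) hsx),
    Ideal.IsPrime.mul_mem_left_iff (mt (y.isPrime.mem_of_pow_mem m) hsy), iff_comm] at this

lemma isMaximal_of_connectedComponent_eq_singleton {F : Type*} [CommRing F]
    {x : PrimeSpectrum F} (hx : connectedComponent x = {x}) : x.asIdeal.IsMaximal := by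
  rw [← isClosed_singleton_iff_isMaximal, ← hx]
  exact isClosed_connectedComponent

/-- The ideal of elements fixed by multiplication with some idempotent contained in the prime
`x`; equivalently, the ideal generated by the idempotents in `x`. -/
def idempotentIdeal {F : Type*} [CommRing F] (x : PrimeSpectrum F) : Ideal F where
  carrier := {t | ∃ e ∈ x.asIdeal, IsIdempotentElem e ∧ e * t = t}
  zero_mem' := ⟨0, zero_mem _, .zero, by simp⟩
  add_mem' := by
    rintro a b ⟨e, hex, he, hea⟩ ⟨f, hfx, hf, hfb⟩
    refine ⟨e + f - e * f, sub_mem (add_mem hex hfx) (Ideal.mul_mem_right _ _ hex), ?_, ?_⟩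
    · have he' : e * e = e := he
      have hf' : f * f = f := hf
      change (e + f - e * f) * (e + f - e * f) = _
      linear_combination (1 - 2 * f + f * f) * he' + (1 - e) * hf'
    · linear_combination (1 - f) * hea + (1 - e) * hfb
  smul_mem' := by
    rintro c a ⟨e, hex, he, hea⟩
    exact ⟨e, hex, he, by rw [smul_eq_mul]; linear_combination c * hea⟩

lemma mem_idempotentIdeal {F : Type*} [CommRing F] {x : PrimeSpectrum F} {t : F} :
    t ∈ x.idempotentIdeal ↔ ∃ e ∈ x.asIdeal, IsIdempotentElem e ∧ e * t = t := Iff.rfl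

lemma idempotentIdeal_le {F : Type*} [CommRing F] (x : PrimeSpectrum F) :
    x.idempotentIdeal ≤ x.asIdeal := by
  rintro t ⟨e, hex, -, het⟩
  exact het ▸ Ideal.mul_mem_right _ _ hex

lemma isPreconnected_zeroLocus_idempotentIdeal {F : Type*} [CommRing F] (x : PrimeSpectrum F) :
    IsPreconnected (zeroLocus (x.idempotentIdeal : Set F)) := by
  set I := x.idempotentIdeal
  have : PreconnectedSpace (PrimeSpectrum (F ⧸ I)) := by
    refine preconnectedSpace_iff_clopen.mpr fun s hs ↦ ?_
    obtain ⟨e, he, rfl⟩ := isClopen_iff.mp hs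
    obtain ⟨t, rfl⟩ := Ideal.Quotient.mk_surjective e
    have ht : t * t - t ∈ I := by
      rw [← Ideal.Quotient.eq_zero_iff_mem, map_sub, map_mul, sub_eq_zero]
      exact he
    obtain ⟨f, hfx, hf, hft⟩ := ht
    have hfI : f ∈ I := ⟨f, hfx, hf, hf⟩
    have hg : IsIdempotentElem ((1 - f) * t) := by
      have hf' : f * f = f := hf
      change (1 - f) * t * ((1 - f) * t) = _
      linear_combination t * t * hf' - hft
    have hmk : Ideal.Quotient.mk I ((1 - f) * t) = Ideal.Quotient.mk I t := by
      rw [map_mul, map_sub, Ideal.Quotient.eq_zero_iff_mem.mpr hfI]; simp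
    rw [← hmk]
    have hmem : (1 - f) * t * (1 - (1 - f) * t) ∈ x.asIdeal := by
      have : (1 - f) * t * (1 - (1 - f) * t) = 0 := by
        have hg' : ((1 - f) * t) * ((1 - f) * t) = (1 - f) * t := hg
        linear_combination - hg'
      rw [this]; exact zero_mem _
    rcases x.isPrime.mem_or_mem hmem with h | h
    · left
      have : (1 - f) * t ∈ I := ⟨_, h, hg, hg⟩
      simp [Ideal.Quotient.eq_zero_iff_mem.mpr this]
    · right
      have : 1 - (1 - f) * t ∈ I := ⟨_, h, hg.one_sub, hg.one_sub⟩
      rw [← Ideal.Quotient.eq_zero_iff_mem, map_sub, sub_eq_zero, map_one] at this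
      simp [← this]
  have h := isPreconnected_range (continuous_comap (Ideal.Quotient.mk I))
  rwa [range_comap_of_surjective _ _ Ideal.Quotient.mk_surjective, Ideal.mk_ker] at h

lemma asIdeal_le_radical_idempotentIdeal {F : Type*} [CommRing F] {x : PrimeSpectrum F}
    (hx : connectedComponent x = {x}) : x.asIdeal ≤ x.idempotentIdeal.radical := by
  have h := (isPreconnected_zeroLocus_idempotentIdeal x).subset_connectedComponent
    (x := x) x.idempotentIdeal_le
  rw [hx] at h
  rw [← vanishingIdeal_zeroLocus_eq_radical, ← vanishingIdeal_singleton]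
  exact vanishingIdeal_anti_mono h

lemma exists_isIdempotentElem_le_span_of_fg {F : Type*} [CommRing F] {x : PrimeSpectrum F}
    (I : Ideal F) (hI : I.FG) (h : I ≤ x.idempotentIdeal) :
    ∃ e ∈ x.asIdeal, IsIdempotentElem e ∧ I ≤ Ideal.span {e} := by
  induction I, hI using Submodule.fg_induction with
  | singleton t =>
    obtain ⟨e, hex, he, het⟩ := h (Ideal.subset_span rfl)
    refine ⟨e, hex, he, ?_⟩
    rw [Submodule.span_singleton_le_iff_mem, ← het]
    exact Ideal.mul_mem_right _ _ (Ideal.mem_span_singleton_self e)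
  | sup I J hI hJ hI' hJ' =>
    obtain ⟨e, hex, he, heI⟩ := hI' (le_sup_left.trans h)
    obtain ⟨f, hfx, hf, hfJ⟩ := hJ' (le_sup_right.trans h)
    have he' : e * e = e := he
    have hf' : f * f = f := hf
    refine ⟨e + f - e * f, sub_mem (add_mem hex hfx) (Ideal.mul_mem_right _ _ hex), ?_,
      sup_le (heI.trans ?_) (hfJ.trans ?_)⟩
    · change (e + f - e * f) * (e + f - e * f) = _
      linear_combination (1 - 2 * f + f * f) * he' + (1 - e) * hf'
    · rw [Ideal.span_singleton_le_span_singleton]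
      exact ⟨e, by linear_combination (f - 1) * he'⟩
    · rw [Ideal.span_singleton_le_span_singleton]
      exact ⟨f, by linear_combination (e - 1) * hf'⟩

/-- If `F` is integral over a Noetherian ring and `{x}` is a connected component of `Spec F`, then
`x` has a clopen neighbourhood consisting of closed points. -/
lemma exists_isIdempotentElem_forall_isMaximal {G F : Type*} [CommRing G] [IsNoetherianRing G]
    [CommRing F] (g : G →+* F) (hg : g.IsIntegral) {x : PrimeSpectrum F}
    (hx : connectedComponent x = {x}) :
    ∃ e ∈ x.asIdeal, IsIdempotentElem e ∧
      ∀ P : Ideal F, P.IsPrime → e ∈ P → P.IsMaximal := by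
  have := isMaximal_of_connectedComponent_eq_singleton hx
  set n := x.asIdeal.comap g
  have hn : n.IsMaximal := Ideal.isMaximal_comap_of_isIntegral_of_isMaximal' g hg x.asIdeal
  have hfg : (n.map g).FG := Ideal.FG.map (IsNoetherian.noetherian n) g
  have hle : n.map g ≤ x.asIdeal := Ideal.map_comap_le
  obtain ⟨k, hk⟩ := Ideal.exists_pow_le_of_le_radical_of_fg
    (hle.trans (asIdeal_le_radical_idempotentIdeal hx)) hfg
  obtain ⟨e, hex, he, hle'⟩ := exists_isIdempotentElem_le_span_of_fg _ (hfg.pow) hk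
  refine ⟨e, hex, he, fun P hP heP ↦ ?_⟩
  have h : n ≤ P.comap g := by
    rw [← Ideal.map_le_iff_le_comap]
    exact hP.le_of_pow_le (hle'.trans ((Ideal.span_singleton_le_iff_mem _).mpr heP))
  have : (P.comap g).IsMaximal := by
    rwa [← hn.eq_of_le (hP.comap g).ne_top h]
  exact Ideal.isMaximal_of_isIntegral_of_isMaximal_comap' g hg P this

lemma isOpen_singleton_of_minimal_of_isMaximal {F : Type*} [CommRing F] [IsNoetherianRing F]
    {x : PrimeSpectrum F} (hmin : ∀ P : Ideal F, P.IsPrime → P ≤ x.asIdeal → P = x.asIdeal)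
    (hmax : x.asIdeal.IsMaximal) : IsOpen {x} := by
  rw [← isClosed_compl_iff]
  have : ({x}ᶜ : Set (PrimeSpectrum F)) =
      ⋃ P ∈ minimalPrimes F \ {x.asIdeal}, zeroLocus (P : Set F) := by
    ext y
    simp only [Set.mem_compl_iff, Set.mem_singleton_iff, Set.mem_iUnion, mem_zeroLocus,
      SetLike.coe_subset_coe, exists_prop]
    constructor
    · intro hy
      obtain ⟨P, hP, hPy⟩ := Ideal.exists_minimalPrimes_le (bot_le : ⊥ ≤ y.asIdeal)
      refine ⟨P, ⟨hP, fun h ↦ hy ?_⟩, hPy⟩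
      rw [Set.mem_singleton_iff] at h
      subst h
      exact PrimeSpectrum.ext (hmax.eq_of_le y.isPrime.ne_top hPy).symm
    · rintro ⟨P, ⟨hP, hPx⟩, hPy⟩ rfl
      exact hPx (hmin P hP.1.1 hPy)
  rw [this]
  exact ((minimalPrimes.finite_of_isNoetherianRing F).subset Set.sdiff_subset).isClosed_biUnion
    fun P _ ↦ isClosed_zeroLocus _

/-- Descent of isolatedness along an integral map that is surjective on spectra. -/
lemma isOpen_singleton_comap {F₁ F : Type*} [CommRing F₁] [IsNoetherianRing F₁] [CommRing F]
    (h : F₁ →+* F) (hint : h.IsIntegral) (hsurj : Function.Surjective (comap h))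
    {x : PrimeSpectrum F} {c : F₁} (hcx : h c ∈ x.asIdeal) (hc : IsIdempotentElem (h c))
    (H : ∀ P : Ideal F, P.IsPrime → h c ∈ P → P.IsMaximal) : IsOpen {comap h x} := by
  have hcomap (P : Ideal F) (hP : P.IsPrime) (hcP : h c ∈ P) : (P.comap h).IsMaximal :=
    have := H P hP hcP
    Ideal.isMaximal_comap_of_isIntegral_of_isMaximal' h hint P
  refine isOpen_singleton_of_minimal_of_isMaximal (fun P hP hPx ↦ ?_) (hcomap _ x.isPrime hcx)
  obtain ⟨y, hy⟩ := hsurj ⟨P, hP⟩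
  obtain rfl : y.asIdeal.comap h = P := congr(($hy).asIdeal)
  refine (hcomap _ y.isPrime ?_).eq_of_le (comap h x).isPrime.ne_top hPx
  have h0 : h c * (1 - h c) ∈ y.asIdeal := by
    rw [hc.mul_one_sub_self]; exact zero_mem _
  refine (y.isPrime.mem_or_mem h0).resolve_right fun h1 ↦ ?_
  have h2 : 1 - c ∈ x.asIdeal.comap h := hPx (by simpa using h1)
  refine x.isPrime.ne_top ((Ideal.eq_top_iff_one _).mpr ?_)
  simpa using add_mem (show h (1 - c) ∈ x.asIdeal from h2) hcx

end PrimeSpectrum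

section Fiber

variable {R A : Type*} [CommRing R] [CommRing A] [Algebra R A]

lemma Subalgebra.isIntegral_tensorProductMap_val (B : Subalgebra R A) [Algebra.IsIntegral B A]
    (K : Type*) [CommRing K] [Algebra R K] :
    (Algebra.TensorProduct.map (AlgHom.id K K) B.val).toRingHom.IsIntegral := by
  set f := Algebra.TensorProduct.map (AlgHom.id K K) B.val
  intro t
  induction t using TensorProduct.induction_on with
  | zero => exact f.toRingHom.isIntegralElem_zero
  | add a b ha hb => exact RingHom.IsIntegralElem.add _ ha hb
  | tmul k a =>
    rw [show k ⊗ₜ[R] a = f (k ⊗ₜ 1) * (1 ⊗ₜ a) by simp [f]]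
    refine RingHom.IsIntegralElem.mul _ f.toRingHom.isIntegralElem_map ?_
    algebraize [f.toRingHom]
    refine IsIntegral.map_of_comp_eq
      (Algebra.TensorProduct.includeRight : B →ₐ[R] K ⊗[R] B).toRingHom
      (Algebra.TensorProduct.includeRight : A →ₐ[R] K ⊗[R] A).toRingHom ?_
      (Algebra.IsIntegral.isIntegral (R := B) a)
    ext b
    simp [RingHom.algebraMap_toAlgebra, f]

lemma Subalgebra.comap_fiberMap_val_surjective (B : Subalgebra R A) [Algebra.IsIntegral B A]
    (p : Ideal R) [p.IsPrime] :
    Function.Surjective (PrimeSpectrum.comap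
      (Algebra.TensorProduct.map (AlgHom.id p.ResidueField p.ResidueField) B.val).toRingHom) := by
  intro P
  let P₀ := (PrimeSpectrum.preimageEquivFiber R B ⟨p, inferInstance⟩).symm P
  obtain ⟨Q₀, hQ₀⟩ := Algebra.IsIntegral.comap_surjective B A P₀.1
  let Q := PrimeSpectrum.preimageEquivFiber R A ⟨p, inferInstance⟩ ⟨Q₀, by
    rw [Set.mem_preimage, IsScalarTower.algebraMap_eq R B A, PrimeSpectrum.comap_comp_apply, hQ₀]
    exact P₀.2⟩
  refine ⟨Q, (PrimeSpectrum.preimageEquivFiber R B ⟨p, inferInstance⟩).symm.injective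
    (Subtype.ext ?_)⟩
  have h : (PrimeSpectrum.preimageEquivFiber R A ⟨p, inferInstance⟩).symm Q = ⟨Q₀, _⟩ :=
    Equiv.symm_apply_apply _ _
  refine Eq.trans ?_ hQ₀
  refine Eq.trans ?_ congr(PrimeSpectrum.comap (algebraMap B A) ($h).1)
  rfl

lemma Subalgebra.exists_isIntegral_pow_mul (B : Subalgebra R A) [Algebra.IsIntegral B A]
    {r : A} (hr : IsIntegral R r) (H : ∀ b ∈ B, ∃ m, IsIntegral R (r ^ m * b)) (a : A) :
    ∃ m, IsIntegral R (r ^ m * a) := by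
  rcases subsingleton_or_nontrivial A with _ | _
  · exact ⟨0, by rw [Subsingleton.elim (r ^ 0 * a) 0]; exact isIntegral_zero⟩
  obtain ⟨f, hf, hfa⟩ := Algebra.IsIntegral.isIntegral (R := B) a
  choose! m hm using H
  let N := f.support.sup fun i ↦ m (f.coeff i)
  let C := integralClosure R A
  let g := (f.map (algebraMap B A)).scaleRoots (r ^ N)
  have hg : g.Monic := (Polynomial.monic_scaleRoots_iff _).mpr (hf.map _)
  have hlift : g ∈ Polynomial.lifts (algebraMap C A) := by
    rw [Polynomial.lifts_iff_coeff_lifts]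
    intro i
    suffices IsIntegral R (g.coeff i) from ⟨⟨_, this⟩, rfl⟩
    simp only [g, Polynomial.coeff_scaleRoots, Polynomial.coeff_map]
    rcases lt_trichotomy i f.natDegree with hi | rfl | hi
    · rw [hf.natDegree_map, ← Nat.sub_add_cancel (Nat.sub_pos_of_lt hi), pow_succ', ← mul_assoc]
      refine .mul ?_ ((hr.pow _).pow _)
      by_cases h0 : f.coeff i = 0
      · simpa [h0] using isIntegral_zero
      have hle : m (f.coeff i) ≤ N := Finset.le_sup (f := fun i ↦ m (f.coeff i))
        (Polynomial.mem_support_iff.mpr h0)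
      rw [← Nat.sub_add_cancel hle, pow_add, mul_comm, mul_assoc]
      exact (hr.pow _).mul (hm _ (f.coeff i).2)
    · simpa [hf.natDegree_map, hf.coeff_natDegree] using isIntegral_one
    · simpa [Polynomial.coeff_eq_zero_of_natDegree_lt hi] using isIntegral_zero
  obtain ⟨q, hq, -, hqm⟩ := Polynomial.lifts_and_natDegree_eq_and_monic hlift hg
  have : IsIntegral C (r ^ N * a) := by
    refine ⟨q, hqm, ?_⟩
    rw [← Polynomial.eval_map, hq]
    rw [← Polynomial.eval_map] at hfa
    have := Polynomial.scaleRoots_aeval_eq_zero (R := A) (A := A) (p := f.map (algebraMap B A))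
      (a := a) (r := r ^ N) (by simpa using hfa)
    simpa using this
  exact ⟨N, isIntegral_trans _ this⟩

end Fiber

section FiberRing

variable {R A : Type*} [CommRing R] [CommRing A] [Algebra R A]

/-- `fiberRing R A p` is the fibre `κ(p) ⊗ A` with the two factors swapped. -/
noncomputable def fiberRingEquiv (p : Ideal R) [p.IsPrime] :
    fiberRing R A p ≃ₐ[R] p.Fiber A :=
  (Algebra.TensorProduct.comm R A (FractionRing (R ⧸ p))).trans
    (Algebra.TensorProduct.congr
      ((FractionRing.algEquiv (R ⧸ p) p.ResidueField).restrictScalars R) AlgEquiv.refl)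

lemma fiberRingEquiv_tmul_one (p : Ideal R) [p.IsPrime] (a : A) :
    fiberRingEquiv p (a ⊗ₜ 1) = 1 ⊗ₜ a := by
  simp [fiberRingEquiv]

lemma quasiIsolatedInFiber_iff_forall {q : PrimeSpectrum A} :
    QuasiIsolatedInFiber R q ↔
      ∀ x : PrimeSpectrum ((q.asIdeal.comap (algebraMap R A)).Fiber A),
        x.comap Algebra.TensorProduct.includeRight.toRingHom = q →
          connectedComponent x = {x} := by
  set p := q.asIdeal.comap (algebraMap R A)
  let e := PrimeSpectrum.homeomorphOfRingEquiv (fiberRingEquiv (A := A) p).toRingEquiv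
  refine e.toEquiv.forall_congr fun x ↦ imp_congr ?_ ?_
  · have h : (fiberRingEquiv p).symm.toRingEquiv.toRingHom.comp
        (Algebra.TensorProduct.includeRight : A →ₐ[R] p.Fiber A).toRingHom =
          Algebra.TensorProduct.includeLeftRingHom := by
      ext a
      exact (fiberRingEquiv p).symm_apply_eq.mpr (fiberRingEquiv_tmul_one p a).symm
    rw [← h, PrimeSpectrum.comap_comp_apply]
    rfl
  · exact (e.connectedComponent_eq_singleton_iff x).symm

/-- Every prime of `A` comes from a point of its fibre. -/
lemma exists_comap_includeRight_eq (q : PrimeSpectrum A) :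
    ∃ x : PrimeSpectrum ((q.asIdeal.comap (algebraMap R A)).Fiber A),
      x.comap Algebra.TensorProduct.includeRight.toRingHom = q :=
  let e := PrimeSpectrum.preimageEquivFiber R A (q.comap (algebraMap R A))
  ⟨e ⟨q, rfl⟩, congr(($(e.symm_apply_apply ⟨q, rfl⟩)).1)⟩

lemma QuasiIsolatedInFiber.of_zariskisMainProperty {q : PrimeSpectrum A}
    (H : Algebra.ZariskisMainProperty R q.asIdeal) : QuasiIsolatedInFiber R q := by
  rw [quasiIsolatedInFiber_iff_forall]
  rintro x hx
  obtain ⟨s, hsq, hs, H⟩ := Algebra.zariskisMainProperty_iff.mp H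
  set p := q.asIdeal.comap (algebraMap R A)
  have map_isIntegral {a : A} (ha : IsIntegral R a) :
      IsIntegral p.ResidueField (1 ⊗ₜ a : p.Fiber A) :=
    (ha.map (Algebra.TensorProduct.includeRight : A →ₐ[R] p.Fiber A)).tower_top
  refine x.connectedComponent_eq_singleton_of_isIntegral_pow_mul (K := p.ResidueField)
    (1 ⊗ₜ s) (fun h ↦ hsq (hx ▸ h)) (map_isIntegral hs) fun t ↦ ?_
  obtain ⟨r, hr, a, hra⟩ := Ideal.Fiber.exists_smul_eq_one_tmul p t
  obtain ⟨m, hm⟩ := H a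
  have hr' : algebraMap R p.ResidueField r ≠ 0 := by simpa using hr
  refine ⟨m, ?_⟩
  have ht : t = (algebraMap R p.ResidueField r)⁻¹ • (1 ⊗ₜ a) := by
    rw [← hra, ← algebraMap_smul p.ResidueField r t, inv_smul_smul₀ hr']
  have hst : (1 ⊗ₜ s) ^ m * t = (algebraMap R p.ResidueField r)⁻¹ • (1 ⊗ₜ (s ^ m * a)) := by
    rw [ht, mul_smul_comm, Algebra.TensorProduct.tmul_pow, Algebra.TensorProduct.tmul_mul_tmul,
      one_pow, one_mul]
  rw [hst]
  exact (map_isIntegral hm).smul _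

lemma QuasiIsolatedInFiber.zariskisMainProperty (hA : Algebra.FiniteExpansion R A)
    {q : PrimeSpectrum A} (hq : QuasiIsolatedInFiber R q) :
    Algebra.ZariskisMainProperty R q.asIdeal := by
  classical
  obtain ⟨s, hs⟩ := hA
  obtain ⟨x, hx⟩ := exists_comap_includeRight_eq (R := R) q
  have hcc := quasiIsolatedInFiber_iff_forall.mp hq x hx
  set p := q.asIdeal.comap (algebraMap R A) with hp
  let B := Algebra.adjoin R (s : Set A)
  have : Algebra.FiniteType R B := ⟨(Subalgebra.fg_top _).mpr ⟨s, rfl⟩⟩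
  have : IsNoetherianRing (p.ResidueField ⊗[R] B) :=
    Algebra.FiniteType.isNoetherianRing p.ResidueField _
  obtain ⟨e, hex, he, H⟩ := PrimeSpectrum.exists_isIdempotentElem_forall_isMaximal _
    (B.isIntegral_tensorProductMap_val p.ResidueField) hcc
  obtain ⟨r, hr, a, hra⟩ := Ideal.Fiber.exists_smul_eq_one_tmul p e
  have hr' : algebraMap R p.ResidueField r ≠ 0 := by simpa using hr
  let B₁ := Algebra.adjoin R ((insert a s : Finset A) : Set A)
  have : Algebra.FiniteType R B₁ := ⟨(Subalgebra.fg_top _).mpr ⟨_, rfl⟩⟩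
  have : IsNoetherianRing (p.ResidueField ⊗[R] B₁) :=
    Algebra.FiniteType.isNoetherianRing p.ResidueField _
  have hB : B ≤ B₁ := Algebra.adjoin_mono (by simp)
  have : Algebra.IsIntegral B₁ A := by
    algebraize [(Subalgebra.inclusion hB).toRingHom]
    have : IsScalarTower B B₁ A := .of_algebraMap_eq fun _ ↦ rfl
    exact .tower_top B
  let h := (Algebra.TensorProduct.map (AlgHom.id p.ResidueField p.ResidueField) B₁.val)
  let a₁ : B₁ := ⟨a, Algebra.subset_adjoin (by simp)⟩
  let c : p.ResidueField ⊗[R] B₁ := (algebraMap R p.ResidueField r)⁻¹ • (1 ⊗ₜ a₁)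
  have hc : h c = e := by
    have : h c = (algebraMap R p.ResidueField r)⁻¹ • (1 ⊗ₜ a) := by simp [h, c, a₁]
    rw [this, ← hra, ← algebraMap_smul p.ResidueField r e, inv_smul_smul₀ hr']
  have hopen : IsOpen {x.comap h.toRingHom} :=
    PrimeSpectrum.isOpen_singleton_comap h.toRingHom
      (B₁.isIntegral_tensorProductMap_val p.ResidueField) (B₁.comap_fiberMap_val_surjective p)
      (c := c) (hc.symm ▸ hex) (hc.symm ▸ he) (hc.symm ▸ H)
  have := Algebra.QuasiFiniteAt.of_isOpen_singleton (R := p.ResidueField) _ hopen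
  have hlies : (q.asIdeal.comap (algebraMap B₁ A)).LiesOver p := ⟨by
    rw [hp, Ideal.under, Ideal.comap_comap, ← IsScalarTower.algebraMap_eq]⟩
  have hx₁ : (x.comap h.toRingHom).asIdeal.comap
      Algebra.TensorProduct.includeRight.toRingHom = q.asIdeal.comap (algebraMap B₁ A) := by
    refine Eq.trans ?_ congr(($hx).asIdeal.comap (algebraMap B₁ A))
    rfl
  have : Algebra.WeaklyQuasiFiniteAt R (q.asIdeal.comap (algebraMap B₁ A)) :=
    .of_quasiFiniteAt_residueField (p := p) _ _ hx₁
  obtain ⟨t, htq, ht, Ht⟩ := Algebra.zariskisMainProperty_iff.mp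
    (Algebra.ZariskisMainProperty.of_finiteType_of_weaklyQuasiFiniteAt (R := R)
      (q.asIdeal.comap (algebraMap B₁ A)))
  refine Algebra.zariskisMainProperty_iff.mpr ⟨t, htq, ht.map B₁.val,
    B₁.exists_isIntegral_pow_mul (ht.map B₁.val) fun b hb ↦ ?_⟩
  obtain ⟨m, hm⟩ := Ht ⟨b, hb⟩
  exact ⟨m, hm.map B₁.val⟩

end FiberRing

/-- For an `R`-algebra `A` of finite expansion with `R'` the integral closure of `R` in `A`,
the set of primes of `A` that are quasi-isolated in their fibre over `Spec R` coincides with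
the set of primes `q` of `A` admitting some `s ∈ R'` with `s ∉ q` such that the induced map
`(R')_s → A_s` is an isomorphism; in particular this set is open in `Spec A`. -/
theorem qIsol_eq_locIsom (R A : Type*) [CommRing R] [CommRing A] [Algebra R A]
    (hA : Algebra.FiniteExpansion R A) :
    {q : PrimeSpectrum A | QuasiIsolatedInFiber R q} =
        {q : PrimeSpectrum A | ∃ s : integralClosure R A, (s : A) ∉ q.asIdeal ∧
          Function.Bijective (Localization.awayMap (algebraMap (integralClosure R A) A) s)} ∧
      IsOpen {q : PrimeSpectrum A | QuasiIsolatedInFiber R q} := by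
  have heq : {q : PrimeSpectrum A | QuasiIsolatedInFiber R q} =
      {q : PrimeSpectrum A | ∃ s : integralClosure R A, (s : A) ∉ q.asIdeal ∧
        Function.Bijective (Localization.awayMap (algebraMap (integralClosure R A) A) s)} :=
    Set.ext fun q ↦ ⟨fun hq ↦ hq.zariskisMainProperty hA, .of_zariskisMainProperty⟩
  refine ⟨heq, heq ▸ isOpen_iff_forall_mem_open.mpr ?_⟩
  rintro q ⟨s, hsq, hs⟩
  exact ⟨_, fun q' hq' ↦ ⟨s, hq', hs⟩, (PrimeSpectrum.basicOpen (s : A)).isOpen, hsq⟩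
end

section
/- Let f : X ⟶ Y be a separated universally closed morphism of quasi-compact quasi-separated schemes. Then f can be decomposed as f = h ∘ g for some scheme Z and morphisms g : X ⟶ Z and h : Z ⟶ Y, with g an integral morphism and h a proper morphism. -/
open AlgebraicGeometry CategoryTheory
open Limits TopologicalSpace

universe u

namespace AlgebraicGeometry

instance : IsZariskiLocalAtTarget (@QuasiCompact : MorphismProperty Scheme.{u}) :=
  @HasAffineProperty.instIsZariskiLocalAtTarget _ _
    instHasAffinePropertyQuasiCompactCompactSpaceCarrierCarrierCommRingCat

instance : IsZariskiLocalAtTarget (@IsAffineHom : MorphismProperty Scheme.{u}) :=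
  @HasAffineProperty.instIsZariskiLocalAtTarget _ _ instHasAffinePropertyIsAffineHomIsAffine

instance : IsZariskiLocalAtTarget (@LocallyOfFiniteType : MorphismProperty Scheme.{u}) :=
  HasRingHomProperty.instIsZariskiLocalAtTarget (P := @LocallyOfFiniteType)
    (Q := RingHom.FiniteType)

/-- Two jointly surjective open immersions, as an open cover. -/
noncomputable def Scheme.openCoverOfPair {X X₁ X₂ : Scheme.{u}} (x₁ : X₁ ⟶ X) (x₂ : X₂ ⟶ X)
    [IsOpenImmersion x₁] [IsOpenImmersion x₂] (hx : x₁.opensRange ⊔ x₂.opensRange = ⊤) :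
    X.OpenCover :=
  .mkOfCovers Bool (fun b ↦ Bool.rec X₂ X₁ b) (fun b ↦ Bool.rec x₂ x₁ b)
    (fun x ↦ by
      have : x ∈ x₁.opensRange ⊔ x₂.opensRange := hx ▸ trivial
      rcases this with ⟨y, hy⟩ | ⟨y, hy⟩
      exacts [⟨true, y, hy⟩, ⟨false, y, hy⟩])
    (fun b ↦ by cases b <;> assumption)

/-- A pullback square of open immersions whose two legs to the corner are jointly surjective. -/
structure IsOpenSquare {O W₁ W₂ W : Scheme.{u}} (i₁ : O ⟶ W₁) (i₂ : O ⟶ W₂) (j₁ : W₁ ⟶ W)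
    (j₂ : W₂ ⟶ W) : Prop where
  isPullback : IsPullback i₁ i₂ j₁ j₂
  isOpenImmersion_left : IsOpenImmersion j₁
  isOpenImmersion_right : IsOpenImmersion j₂
  sup_eq_top : j₁.opensRange ⊔ j₂.opensRange = ⊤

namespace IsOpenSquare

variable {O W₁ W₂ W : Scheme.{u}} {i₁ : O ⟶ W₁} {i₂ : O ⟶ W₂} {j₁ : W₁ ⟶ W} {j₂ : W₂ ⟶ W}

lemma of_sup_eq_top [IsOpenImmersion j₁] [IsOpenImmersion j₂]
    (h : j₁.opensRange ⊔ j₂.opensRange = ⊤) :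
    IsOpenSquare (pullback.fst j₁ j₂) (pullback.snd j₁ j₂) j₁ j₂ :=
  ⟨.of_hasPullback _ _, inferInstance, inferInstance, h⟩

lemma symm (h : IsOpenSquare i₁ i₂ j₁ j₂) : IsOpenSquare i₂ i₁ j₂ j₁ :=
  ⟨h.isPullback.flip, h.3, h.2, sup_comm _ _ |>.trans h.4⟩

lemma exists_desc (h : IsOpenSquare i₁ i₂ j₁ j₂) {Z : Scheme.{u}} (f₁ : W₁ ⟶ Z) (f₂ : W₂ ⟶ Z)
    (e : i₁ ≫ f₁ = i₂ ≫ f₂) : ∃ f : W ⟶ Z, j₁ ≫ f = f₁ ∧ j₂ ≫ f = f₂ := by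
  obtain ⟨h, _, _, hs⟩ := h
  let 𝒰 := Scheme.openCoverOfPair j₁ j₂ hs
  have e' : pullback.fst j₁ j₂ ≫ f₁ = pullback.snd j₁ j₂ ≫ f₂ := by
    rw [← h.isoPullback_inv_fst, ← h.isoPullback_inv_snd, Category.assoc, e, Category.assoc]
  let g : ∀ b : Bool, 𝒰.X b ⟶ Z := fun b ↦ Bool.rec f₂ f₁ b
  have hg (x y : Bool) : pullback.fst (𝒰.f x) (𝒰.f y) ≫ g x = pullback.snd _ _ ≫ g y := by
    cases x <;> cases y
    · have : pullback.fst j₂ j₂ = pullback.snd j₂ j₂ := by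
        rw [← cancel_mono j₂, pullback.condition]
      exact congr($this ≫ f₂)
    · have := congr((pullbackSymmetry j₂ j₁).hom ≫ $e')
      simp only [pullbackSymmetry_hom_comp_fst_assoc, pullbackSymmetry_hom_comp_snd_assoc] at this
      exact this.symm
    · exact e'
    · have : pullback.fst j₁ j₁ = pullback.snd j₁ j₁ := by
        rw [← cancel_mono j₁, pullback.condition]
      exact congr($this ≫ f₁)
  exact ⟨𝒰.glueMorphisms g hg, 𝒰.ι_glueMorphisms g hg true, 𝒰.ι_glueMorphisms g hg false⟩

lemma hom_ext (h : IsOpenSquare i₁ i₂ j₁ j₂) {Z : Scheme.{u}} {f g : W ⟶ Z}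
    (h₁ : j₁ ≫ f = j₁ ≫ g) (h₂ : j₂ ≫ f = j₂ ≫ g) : f = g := by
  obtain ⟨h, _, _, hs⟩ := h
  exact (Scheme.openCoverOfPair j₁ j₂ hs).hom_ext _ _ (by rintro (_ | _); exacts [h₂, h₁])

lemma exists_mem (h : IsOpenSquare i₁ i₂ j₁ j₂) (x : W) : (∃ y, j₁ y = x) ∨ ∃ y, j₂ y = x := by
  obtain ⟨h, _, _, hs⟩ := h
  exact (hs ▸ trivial : x ∈ j₁.opensRange ⊔ j₂.opensRange)

lemma exists_of_eq (h : IsOpenSquare i₁ i₂ j₁ j₂) {y₁ : W₁} {y₂ : W₂} (e : j₁ y₁ = j₂ y₂) :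
    ∃ z, i₁ z = y₁ ∧ i₂ z = y₂ := 
  Scheme.exists_preimage_of_isPullback h.isPullback _ _ e

lemma compactSpace (h : IsOpenSquare i₁ i₂ j₁ j₂) [CompactSpace W₁] [CompactSpace W₂] :
    CompactSpace W := by
  have := isCompact_range j₁.continuous |>.union <| isCompact_range j₂.continuous
  rw [← isCompact_univ_iff]
  convert this
  ext x
  simpa using h.exists_mem x

lemma of_isZariskiLocalAtTarget (h : IsOpenSquare i₁ i₂ j₁ j₂) (P : MorphismProperty Scheme.{u})
    [IsZariskiLocalAtTarget P] {Z Z₁ Z₂ : Scheme.{u}} {f : Z ⟶ W} {f₁ : Z₁ ⟶ W₁} {f₂ : Z₂ ⟶ W₂}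
    {k₁ : Z₁ ⟶ Z} {k₂ : Z₂ ⟶ Z} (hp₁ : IsPullback f₁ k₁ j₁ f) (hp₂ : IsPullback f₂ k₂ j₂ f)
    (h₁ : P f₁) (h₂ : P f₂) : P f := by
  obtain ⟨h, _, _, hs⟩ := h
  refine IsZariskiLocalAtTarget.of_openCover (Scheme.openCoverOfPair j₁ j₂ hs) ?_
  rintro (_ | _)
  · exact (P.arrow_mk_iso_iff (Arrow.isoMk hp₂.flip.isoPullback (Iso.refl _)
      hp₂.flip.isoPullback_hom_snd)).mp h₂
  · exact (P.arrow_mk_iso_iff (Arrow.isoMk hp₁.flip.isoPullback (Iso.refl _)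
      hp₁.flip.isoPullback_hom_snd)).mp h₁

lemma quasiCompact_left (h : IsOpenSquare i₁ i₂ j₁ j₂) [QuasiCompact i₂] : QuasiCompact j₁ := by
  have := h.2
  refine h.of_isZariskiLocalAtTarget @QuasiCompact (IsKernelPair.id_of_mono j₁) h.isPullback.flip
    inferInstance ‹_›

lemma quasiSeparatedSpace (h : IsOpenSquare i₁ i₂ j₁ j₂) [QuasiSeparatedSpace W₁]
    [QuasiSeparatedSpace W₂] [CompactSpace O] : QuasiSeparatedSpace W := by
  have hr {A B : Scheme.{u}} (f : A ⟶ B) [QuasiCompact f] : IsRetrocompact (Set.range f) := by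
    intro s hs hs'
    rw [← Set.image_preimage_eq_range_inter]
    exact (QuasiCompact.isCompact_preimage s hs' hs).image f.continuous
  have hq {A B : Scheme.{u}} (f : A ⟶ B) [IsOpenImmersion f] [QuasiSeparatedSpace A] :
      IsQuasiSeparated (Set.range f) := by
    rw [← Set.image_univ]
    exact isQuasiSeparated_univ.image_of_isEmbedding f.isOpenEmbedding.isEmbedding
  have : QuasiCompact i₁ := inferInstance
  have : QuasiCompact i₂ := inferInstance
  have := h.quasiCompact_left
  have := h.symm.quasiCompact_left
  obtain ⟨h, _, _, hs⟩ := h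
  have ho : IsOpenCover fun b : Bool ↦ (Bool.rec j₂.opensRange j₁.opensRange b : W.Opens) := by
    rw [IsOpenCover, iSup_bool_eq, hs]
  refine .of_isOpenCover ho ?_ ?_
  · rintro (_ | _)
    exacts [hr j₂, hr j₁]
  · rintro (_ | _)
    exacts [hq j₂, hq j₁]

theorem exists_of_isOpenImmersion (i₁ : O ⟶ W₁) (i₂ : O ⟶ W₂) [IsOpenImmersion i₁]
    [IsOpenImmersion i₂] : ∃ (W : Scheme.{u}) (j₁ : W₁ ⟶ W) (j₂ : W₂ ⟶ W),
    IsOpenSquare i₁ i₂ j₁ j₂ := by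
  let 𝒰 : (pushout i₁ i₂).OpenCover := Scheme.IsLocallyDirected.openCover (span i₁ i₂)
  have h₁ : IsOpenImmersion (pushout.inl i₁ i₂) := 𝒰.map_prop (some .left)
  have h₂ : IsOpenImmersion (pushout.inr i₁ i₂) := 𝒰.map_prop (some .right)
  refine ⟨_, pushout.inl i₁ i₂, pushout.inr i₁ i₂, ?_, h₁, h₂, ?_⟩
  · refine (IsOpenImmersion.isPullback i₂ i₁ _ _ pushout.condition ?_).flip
    ext x
    constructor
    · rintro ⟨y, hy⟩
      obtain ⟨k, fi, fj, z, hi, hj⟩ := (Scheme.IsLocallyDirected.ι_eq_ι_iff (span i₁ i₂)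
        (i := some .left) (j := some .right)).mp hy.symm
      obtain _ | _ | _ := k
      · obtain rfl : fi = WalkingSpan.Hom.fst := Subsingleton.elim _ _
        exact ⟨z, hi⟩
      · exact nomatch fj
      · exact nomatch fi
    · rintro ⟨y, rfl⟩
      exact ⟨i₂ y, by simp only [← Scheme.Hom.comp_apply, pushout.condition]⟩
  · refine top_le_iff.mp fun x _ ↦ ?_
    obtain ⟨_ | _ | _, y, rfl⟩ :=
      Scheme.IsLocallyDirected.ι_jointly_surjective (span i₁ i₂) x
    · exact Or.inl ⟨i₁ y, congr($(colimit.w (span i₁ i₂) WalkingSpan.Hom.fst) y)⟩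
    · exact Or.inl ⟨y, rfl⟩
    · exact Or.inr ⟨y, rfl⟩

end IsOpenSquare

/-- A morphism glued from two pieces restricts to each piece. -/
lemma IsOpenSquare.isPullback_left {O W₁ W₂ W O' W₁' W₂' W' : Scheme.{u}} {i₁ : O ⟶ W₁} {i₂ : O ⟶ W₂}
    {j₁ : W₁ ⟶ W} {j₂ : W₂ ⟶ W} {i₁' : O' ⟶ W₁'} {i₂' : O' ⟶ W₂'}
    {j₁' : W₁' ⟶ W'} {j₂' : W₂' ⟶ W'} (h : IsOpenSquare i₁ i₂ j₁ j₂)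
    (h' : IsOpenSquare i₁' i₂' j₁' j₂') {a : O' ⟶ O} {a₁ : W₁' ⟶ W₁} {a₂ : W₂' ⟶ W₂}
    {b : W' ⟶ W} (hb₁ : j₁' ≫ b = a₁ ≫ j₁) (hb₂ : j₂' ≫ b = a₂ ≫ j₂)
    (ha : IsPullback a i₂' i₂ a₂) : IsPullback a₁ j₁' j₁ b := by
  have := h.2; have := h'.2
  have := h.3; have := h'.3
  refine IsOpenImmersion.isPullback _ _ _ _ hb₁ ?_
  ext x
  constructor
  · rintro ⟨y, hy⟩
    obtain ⟨z, rfl⟩ | ⟨z, rfl⟩ := h'.exists_mem x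
    · exact ⟨z, rfl⟩
    · rw [← Scheme.Hom.comp_apply, hb₂, Scheme.Hom.comp_apply] at hy
      obtain ⟨t, rfl, ht⟩ := h.exists_of_eq hy
      obtain ⟨s, hs, rfl⟩ := Scheme.exists_preimage_of_isPullback ha _ _ ht
      exact ⟨i₁' s, by simp only [← Scheme.Hom.comp_apply, h'.isPullback.w]⟩
  · rintro ⟨y, rfl⟩
    exact ⟨a₁ y, by simp only [← Scheme.Hom.comp_apply, hb₁]⟩

end AlgebraicGeometry

namespace AlgebraicGeometry

lemma exists_pow_smul_mem_of_mem_adjoin {R M : Type*} [CommRing R] [CommRing M] [Algebra R M]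
    (r : R) (C : Subalgebra R M) {S : Set M} (h : ∀ s ∈ S, ∃ n : ℕ, r ^ n • s ∈ C) {x : M}
    (hx : x ∈ Algebra.adjoin R S) : ∃ n : ℕ, r ^ n • x ∈ C := by
  induction hx using Algebra.adjoin_induction with
  | mem x hx => exact h x hx
  | algebraMap s => exact ⟨0, by simp⟩
  | add x y _ _ hx hy =>
    obtain ⟨n, hn⟩ := hx
    obtain ⟨m, hm⟩ := hy
    refine ⟨n + m, ?_⟩
    have h₁ := C.smul_mem hn (r ^ m)
    have h₂ := C.smul_mem hm (r ^ n)
    rw [smul_smul] at h₁ h₂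
    rw [smul_add, pow_add]
    exact add_mem (by rwa [mul_comm]) h₂
  | mul x y _ _ hx hy =>
    obtain ⟨n, hn⟩ := hx
    obtain ⟨m, hm⟩ := hy
    exact ⟨n + m, by
      rw [pow_add, ← smul_mul_smul_comm]; exact mul_mem hn hm⟩

/-- An algebra whose localization at `r` is of finite type is generated, up to powers of `r`,
by finitely many elements. -/
lemma exists_finset_pow_smul_mem_adjoin {R Q M : Type*} [CommRing R] [CommRing Q] [CommRing M]
    [Algebra R Q] [Algebra R M] [Algebra Q M] [IsScalarTower R Q M] (r : R)
    [IsLocalization.Away (algebraMap R Q r) M] [Algebra.FiniteType R M] :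
    ∃ S : Finset Q, ∀ q : Q, ∃ n : ℕ, r ^ n • q ∈ Algebra.adjoin R (S : Set Q) := by
  classical
  obtain ⟨t, ht⟩ := Algebra.FiniteType.out (R := R) (A := M)
  have H (x : M) : ∃ s : Q, ∃ n : ℕ, r ^ n • x = algebraMap Q M s := by
    obtain ⟨n, s, hs⟩ := IsLocalization.Away.surj (algebraMap R Q r) x
    refine ⟨s, n, ?_⟩
    rw [← hs, Algebra.smul_def, map_pow, IsScalarTower.algebraMap_apply R Q M, mul_comm]
  choose s n hs using H
  refine ⟨t.image s, fun q ↦ ?_⟩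
  let C : Subalgebra R M := (Algebra.adjoin R (t.image s : Set Q)).map (IsScalarTower.toAlgHom R Q M)
  obtain ⟨m, c, hc, e⟩ := exists_pow_smul_mem_of_mem_adjoin r C (S := t) (fun x hx ↦ ⟨n x, s x,
    Algebra.subset_adjoin (by simpa using ⟨x, hx, rfl⟩), (hs x).symm⟩)
    (ht ▸ Algebra.mem_top : algebraMap Q M q ∈ _)
  have e' : algebraMap Q M c = algebraMap Q M (r ^ m • q) := by
    simpa [Algebra.smul_def, IsScalarTower.algebraMap_apply R Q M] using e
  obtain ⟨⟨_, k, rfl⟩, hk⟩ := (IsLocalization.eq_iff_exists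
    (Submonoid.powers (algebraMap R Q r)) M).mp e'
  refine ⟨k + m, ?_⟩
  have : r ^ (k + m) • q = r ^ k • c := by
    simp only [Algebra.smul_def, map_pow, pow_add, map_mul, mul_assoc] at hk ⊢
    exact hk.symm
  rw [this]
  exact Subalgebra.smul_mem _ hc _

/-- If `A` and `L` become equal after inverting each `r k`, and `Q` becomes of finite type over `R`,
then a finitely generated subalgebra of `A ×_L Q` becomes equal to `Q`. -/
lemma exists_fg_subalgebra_prod {R A Q L ι : Type*} [CommRing R] [CommRing A] [CommRing Q]
    [CommRing L] [Algebra R A] [Algebra R Q] [Algebra R L] (α : A →ₐ[R] L) (β : Q →ₐ[R] L) [Finite ι]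
    (r : ι → R) (h₁ : ∀ k, ∃ S : Finset Q, ∀ q, ∃ n : ℕ, r k ^ n • q ∈ Algebra.adjoin R (S : Set Q))
    (h₂ : ∀ k l, ∃ (n : ℕ) (a : A), α a = r k ^ n • l)
    (h₃ : ∀ k a, α a = 0 → ∃ n : ℕ, r k ^ n • a = 0) :
    ∃ B : Subalgebra R (A × Q), B.FG ∧ (∀ b ∈ B, α b.1 = β b.2) ∧
      (∀ k q, ∃ n : ℕ, ∃ b ∈ B, b.2 = r k ^ n • q) ∧
      (∀ k, ∀ b ∈ B, b.2 = 0 → ∃ n : ℕ, r k ^ n • b = 0) := by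
  classical
  cases nonempty_fintype ι
  choose S hS using h₁
  choose n a ha using h₂
  let G : Finset (A × Q) := Finset.univ.biUnion fun k ↦ (S k).image
    fun s ↦ (a k (β s), r k ^ n k (β s) • s)
  let P : Subalgebra R (A × Q) := AlgHom.equalizer (α.comp (AlgHom.fst R A Q)) (β.comp (AlgHom.snd R A Q))
  have hP : Algebra.adjoin R (G : Set (A × Q)) ≤ P := by
    rw [Algebra.adjoin_le_iff]
    intro b hb
    simp only [G, Finset.coe_biUnion, Finset.coe_image, Set.mem_iUnion, Set.mem_image] at hb
    obtain ⟨k, _, s, hs, rfl⟩ := hb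
    simp [P, ha]
  refine ⟨Algebra.adjoin R G, ⟨G, rfl⟩, fun b hb ↦ hP hb, fun k q ↦ ?_, fun k b hb h ↦ ?_⟩
  · obtain ⟨m, hm⟩ := hS k q
    obtain ⟨l, b, hb, e⟩ := exists_pow_smul_mem_of_mem_adjoin (r k)
      ((Algebra.adjoin R (G : Set (A × Q))).map (AlgHom.snd R A Q)) (S := S k) (fun s hs ↦
      ⟨n k (β s), _, Algebra.subset_adjoin (Finset.mem_coe.mpr <| Finset.mem_biUnion.mpr
        ⟨k, Finset.mem_univ k, Finset.mem_image.mpr ⟨s, hs, rfl⟩⟩), rfl⟩) hm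
    exact ⟨l + m, b, hb, by simpa [pow_add, smul_smul] using e⟩
  · have e : α b.1 = 0 := (hP hb : α b.1 = β b.2).trans (by simp [h])
    obtain ⟨m, hm⟩ := h₃ k _ e
    exact ⟨m, Prod.ext hm (by simp [h])⟩

end AlgebraicGeometry

namespace AlgebraicGeometry

lemma exists_res_eq_pow_mul {X : Scheme.{u}} [CompactSpace X] [QuasiSeparatedSpace X]
    (s : Γ(X, ⊤)) {V : X.Opens} (hV : V = X.basicOpen s) (x : Γ(X, V)) :
    ∃ (n : ℕ) (y : Γ(X, ⊤)), X.presheaf.map (homOfLE le_top).op y =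
      X.presheaf.map (homOfLE le_top).op s ^ n * x := by
  subst hV
  exact exists_eq_pow_mul_of_isCompact_of_isQuasiSeparated X ⊤ isCompact_univ
    isQuasiSeparated_univ s x

lemma exists_pow_mul_eq_zero_of_res_eq_zero {X : Scheme.{u}} [CompactSpace X]
    (s : Γ(X, ⊤)) {V : X.Opens} (hV : V = X.basicOpen s) (x : Γ(X, ⊤))
    (hx : X.presheaf.map (homOfLE le_top : V ⟶ ⊤).op x = 0) : ∃ n : ℕ, s ^ n * x = 0 := by
  subst hV
  exact exists_pow_mul_eq_zero_of_res_basicOpen_eq_zero_of_isCompact X isCompact_univ x s hx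

lemma isUnit_res_of_eq_basicOpen {X : Scheme.{u}} (s : Γ(X, ⊤)) {V : X.Opens}
    (hV : V = X.basicOpen s) : IsUnit (X.presheaf.map (homOfLE le_top : V ⟶ ⊤).op s) := by
  subst hV
  exact X.toRingedSpace.isUnit_res_basicOpen s

lemma isIso_of_isIso_appTop {X Y : Scheme.{u}} (f : X ⟶ Y) [IsAffine X] [IsAffine Y]
    (h : IsIso f.appTop) : IsIso f :=
  (MorphismProperty.arrow_mk_iso_iff (MorphismProperty.isomorphisms _)
    (arrowIsoSpecΓOfIsAffine f)).mpr (inferInstanceAs (IsIso (Spec.map f.appTop)))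

lemma isIso_morphismRestrict_basicOpen {X Y : Scheme.{u}} (f : X ⟶ Y) [CompactSpace X]
    [QuasiSeparatedSpace X] [IsAffine Y] (r : Γ(Y, ⊤)) (h : IsAffineOpen (f ⁻¹ᵁ Y.basicOpen r))
    (hs : ∀ q : Γ(X, ⊤), ∃ (n : ℕ) (b : Γ(Y, ⊤)), f.appTop b = f.appTop r ^ n * q)
    (hi : ∀ b : Γ(Y, ⊤), f.appTop b = 0 → ∃ n : ℕ, r ^ n * b = 0) :
    IsIso (f ∣_ Y.basicOpen r) := by
  have : IsAffine (f ⁻¹ᵁ Y.basicOpen r) := h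
  have : IsAffine (Y.basicOpen r) := (isAffineOpen_top Y).basicOpen r
  have hr : f ⁻¹ᵁ Y.basicOpen r = X.basicOpen (f.appTop r) := Scheme.preimage_basicOpen_top f r
  have hcomp (b : Γ(Y, ⊤)) : f.app (Y.basicOpen r) (Y.presheaf.map (homOfLE le_top).op b) =
      X.presheaf.map (homOfLE le_top).op (f.appTop b) :=
    congr($(f.naturality (homOfLE le_top).op) b)
  have hbij : Function.Bijective (f.app (Y.basicOpen r)) := by
    have hu := isUnit_res_of_eq_basicOpen r rfl
    have hu' := isUnit_res_of_eq_basicOpen _ hr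
    constructor
    · refine (injective_iff_map_eq_zero (f.app (Y.basicOpen r)).hom).mpr fun x hx ↦ ?_
      obtain ⟨n, y, hy⟩ := exists_res_eq_pow_mul r rfl x
      have h0 : X.presheaf.map (homOfLE le_top : f ⁻¹ᵁ Y.basicOpen r ⟶ ⊤).op (f.appTop y) = 0 := by
        rw [← hcomp, hy, map_mul]
        exact (congrArg _ hx).trans (mul_zero _)
      obtain ⟨m, hm⟩ := exists_pow_mul_eq_zero_of_res_eq_zero _ hr _ h0
      rw [← map_pow, ← map_mul] at hm
      obtain ⟨k, hk⟩ := hi _ hm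
      have := congr(Y.presheaf.map (homOfLE le_top : Y.basicOpen r ⟶ ⊤).op $hk)
      rw [map_mul, map_mul, hy, map_zero, map_pow, map_pow] at this
      rwa [(hu.pow _).mul_right_eq_zero, (hu.pow _).mul_right_eq_zero,
        (hu.pow _).mul_right_eq_zero] at this
    · intro x
      obtain ⟨n, y, hy⟩ := exists_res_eq_pow_mul _ hr x
      obtain ⟨m, b, hb⟩ := hs y
      obtain ⟨c, hc⟩ := (hu.pow (m + n)).exists_left_inv
      refine ⟨c * Y.presheaf.map (homOfLE le_top).op b, ?_⟩
      have e := congr(f.app (Y.basicOpen r) $hc)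
      rw [map_mul, map_pow, hcomp, map_one] at e
      rw [map_mul, hcomp, hb, map_mul, hy, map_pow, ← mul_assoc (_ ^ m), ← pow_add, ← mul_assoc, e,
        one_mul]
  have : IsIso (f.app ((Y.basicOpen r).ι ''ᵁ ⊤)) := by
    rw [Scheme.Opens.ι_image_top]
    exact (ConcreteCategory.isIso_iff_bijective _).mpr hbij
  refine isIso_of_isIso_appTop _ ?_
  rw [morphismRestrict_appTop]
  exact IsIso.comp_isIso' this (Functor.map_isIso X.presheaf _)

lemma isLocalization_of_eq_basicOpen {X : Scheme.{u}} [CompactSpace X] [QuasiSeparatedSpace X]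
    (s : Γ(X, ⊤)) {V : X.Opens} (hV : V = X.basicOpen s) :
    letI := (X.presheaf.map (homOfLE le_top : V ⟶ ⊤).op).hom.toAlgebra
    IsLocalization.Away s Γ(X, V) := by
  subst hV
  exact isLocalization_basicOpen_of_qcqs isCompact_univ isQuasiSeparated_univ s

lemma IsOpenImmersion.appTop_eq_pow_mul {X' X : Scheme.{u}} (x : X' ⟶ X) [IsOpenImmersion x]
    [CompactSpace X'] [CompactSpace X] [QuasiSeparatedSpace X] (s : Γ(X, ⊤))
    (hs : X.basicOpen s ≤ x.opensRange) :
    (∀ l : Γ(X', ⊤), ∃ (n : ℕ) (a : Γ(X, ⊤)), x.appTop a = x.appTop s ^ n * l) ∧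
    ∀ a : Γ(X, ⊤), x.appTop a = 0 → ∃ n : ℕ, s ^ n * a = 0 := by
  have := x.isIso_app _ hs
  have hbij : Function.Bijective (x.app (X.basicOpen s)) :=
    (ConcreteCategory.isIso_iff_bijective _).mp this
  have hcomp (b : Γ(X, ⊤)) : x.app (X.basicOpen s) (X.presheaf.map (homOfLE le_top).op b) =
      X'.presheaf.map (homOfLE le_top).op (x.appTop b) :=
    congr($(x.naturality (homOfLE le_top).op) b)
  constructor
  · intro l
    obtain ⟨y, hy⟩ := hbij.2 (X'.presheaf.map (homOfLE le_top).op l)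
    obtain ⟨n, a, ha⟩ := exists_res_eq_pow_mul s rfl y
    obtain ⟨m, hm⟩ := exists_pow_mul_eq_zero_of_res_eq_zero (x.appTop s)
      (Scheme.preimage_basicOpen_top x s) (x.appTop a - x.appTop s ^ n * l) (by
        rw [map_sub, ← hcomp, ha, map_mul, hy, map_pow, hcomp, map_mul, map_pow, sub_self])
    refine ⟨m + n, s ^ m * a, ?_⟩
    rw [map_mul, map_pow, pow_add, mul_assoc, ← sub_eq_zero, ← mul_sub, hm]
  · intro a ha
    refine exists_pow_mul_eq_zero_of_res_eq_zero s rfl a (hbij.1 ?_)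
    rw [hcomp, ha, map_zero, map_zero]

end AlgebraicGeometry

namespace AlgebraicGeometry

lemma isOpenImmersion_of_isIso_morphismRestrict {X Y : Scheme.{u}} (f : X ⟶ Y) {ι : Type*}
    (U : ι → Y.Opens) (hU : f ⁻¹ᵁ (⨆ k, U k) = ⊤) (h : ∀ k, IsIso (f ∣_ U k)) :
    ∃ _ : IsOpenImmersion f, f.opensRange = ⨆ k, U k := by
  set W := ⨆ k, U k with hW
  have : IsIso (f ∣_ W) := by
    refine IsZariskiLocalAtTarget.of_iSup_eq_top (P := MorphismProperty.isomorphisms Scheme)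
      (fun k ↦ W.ι ⁻¹ᵁ U k) ?_ fun k ↦ ?_
    · rw [← Scheme.Hom.preimage_iSup, ← hW, Scheme.Opens.ι_preimage_self]
    · have e : W.ι ''ᵁ (W.ι ⁻¹ᵁ U k) = U k := by
        rw [Scheme.Hom.image_preimage_eq_opensRange_inf, Scheme.Opens.opensRange_ι,
          inf_eq_right.mpr (le_iSup U k)]
      refine (MorphismProperty.arrow_mk_iso_iff _ (morphismRestrictRestrict f W _)).mpr ?_
      refine (MorphismProperty.arrow_mk_iso_iff _ (morphismRestrictEq f e)).mpr (h k)
  have h' : IsIso (f ⁻¹ᵁ W).ι := by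
    rw [hU]; exact X.topIso.isIso_hom
  have e : f = inv (f ⁻¹ᵁ W).ι ≫ f ∣_ W ≫ W.ι := by
    rw [morphismRestrict_ι, IsIso.inv_hom_id_assoc]
  have : IsOpenImmersion f := by
    rw [e]; infer_instance
  refine ⟨this, le_antisymm ?_ ?_⟩
  · rintro _ ⟨y, rfl⟩
    exact (hU ▸ trivial : y ∈ f ⁻¹ᵁ W)
  · intro y hy
    obtain ⟨z, hz⟩ := (f ∣_ W).homeomorph.surjective ⟨y, hy⟩
    refine ⟨(f ⁻¹ᵁ W).ι z, ?_⟩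
    rw [← Scheme.Hom.comp_apply, ← morphismRestrict_ι, Scheme.Hom.comp_apply]
    exact congrArg W.ι hz

lemma exists_iSup_basicOpen_eq {V : Scheme.{u}} [IsAffine V] {O : Scheme.{u}} [CompactSpace O]
    (i : O ⟶ V) [IsOpenImmersion i] :
    ∃ (ι : Type u) (_ : Finite ι) (r : ι → Γ(V, ⊤)), i.opensRange = ⨆ k, V.basicOpen (r k) := by
  obtain ⟨s, hs, e⟩ := (isCompact_and_isOpen_iff_finite_and_eq_biUnion_basicOpen
    (U := (i.opensRange : Set V))).mp ⟨isCompact_range i.continuous, i.opensRange.2⟩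
  refine ⟨s, hs, Subtype.val, ?_⟩
  ext1
  rw [e]
  ext x; simp

lemma preimage_opensRange_of_isPullback {X Y U V : Scheme.{u}} {f : X ⟶ Y} {f' : U ⟶ V}
    {iU : U ⟶ X} {iV : V ⟶ Y} [IsOpenImmersion iV] [IsOpenImmersion iU]
    (H : IsPullback f' iU iV f) : f ⁻¹ᵁ iV.opensRange = iU.opensRange := by
  rw [← Scheme.Hom.image_top_eq_opensRange, ← Scheme.Hom.image_top_eq_opensRange,
    ← IsOpenImmersion.image_preimage_eq_preimage_image_of_isPullback H ⊤]
  rfl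

lemma exists_appTop_eq {X T : Scheme.{u}} [IsAffine T] (φ : Γ(T, ⊤) ⟶ Γ(X, ⊤)) :
    ∃ a : X ⟶ T, a.appTop = φ := by
  refine ⟨X.toSpecΓ ≫ Spec.map φ ≫ T.isoSpec.inv, ?_⟩
  have h : T.toSpecΓ.appTop = (Scheme.ΓSpecIso _).hom := by simp
  have h' : T.isoSpec.inv.appTop = (Scheme.ΓSpecIso _).inv := by
    have : T.toSpecΓ.appTop ≫ T.isoSpec.inv.appTop = 𝟙 _ := by
      rw [← Scheme.Hom.comp_appTop, Scheme.isoSpec_inv_toSpecΓ]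
      rfl
    rw [h] at this
    exact (Iso.hom_comp_eq_id _).mp this
  rw [Scheme.Hom.comp_appTop, Scheme.Hom.comp_appTop, h', Category.assoc,
    ← Scheme.ΓSpecIso_inv_naturality_assoc]
  simp

lemma locallyOfFiniteType_iff_of_isAffine {X Y : Scheme.{u}} [IsAffine X] [IsAffine Y] (f : X ⟶ Y) :
    LocallyOfFiniteType f ↔ f.appTop.hom.FiniteType :=
  HasRingHomProperty.iff_of_isAffine (P := @LocallyOfFiniteType) (Q := RingHom.FiniteType)

theorem exists_extension_of_isAffine {O V X XO T₀ : Scheme.{u}} {i : O ⟶ V} {g : X ⟶ V}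
    {gO : XO ⟶ O} {x : XO ⟶ X} [IsAffine V] [IsAffine X] [CompactSpace O] [IsOpenImmersion i]
    (hX : IsPullback gO x i g) (a₀ : XO ⟶ T₀) (p₀ : T₀ ⟶ O) [IsAffineHom p₀]
    [LocallyOfFiniteType p₀] (h₀ : a₀ ≫ p₀ = gO) :
    ∃ (T : Scheme.{u}) (a : X ⟶ T) (p : T ⟶ V) (j : T₀ ⟶ T), IsAffine T ∧
      LocallyOfFiniteType p ∧ a ≫ p = g ∧ IsPullback p₀ j i p ∧ a₀ ≫ j = x ≫ a := by
  obtain ⟨ι, _, r, hr⟩ := exists_iSup_basicOpen_eq i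
  have hri (k) : V.basicOpen (r k) ≤ i.opensRange :=
    (le_iSup (fun k ↦ V.basicOpen (r k)) k).trans_eq hr.symm
  have : IsAffineHom gO := MorphismProperty.of_isPullback hX.flip inferInstance
  have : IsOpenImmersion x := MorphismProperty.of_isPullback hX inferInstance
  have : CompactSpace XO := QuasiCompact.compactSpace_of_compactSpace gO
  have : CompactSpace T₀ := QuasiCompact.compactSpace_of_compactSpace p₀
  have : QuasiSeparatedSpace T₀ := quasiSeparatedSpace_of_quasiSeparated (p₀ ≫ i)
  let : Algebra Γ(V, ⊤) Γ(X, ⊤) := g.appTop.hom.toAlgebra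
  let : Algebra Γ(V, ⊤) Γ(T₀, ⊤) := (p₀ ≫ i).appTop.hom.toAlgebra
  let : Algebra Γ(V, ⊤) Γ(XO, ⊤) := (x ≫ g).appTop.hom.toAlgebra
  let α : Γ(X, ⊤) →ₐ[Γ(V, ⊤)] Γ(XO, ⊤) := ⟨x.appTop.hom, fun r ↦ by
    change x.appTop (g.appTop r) = (x ≫ g).appTop r
    rw [Scheme.Hom.comp_appTop]
    rfl⟩
  let β : Γ(T₀, ⊤) →ₐ[Γ(V, ⊤)] Γ(XO, ⊤) := ⟨a₀.appTop.hom, fun r ↦ by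
    change a₀.appTop ((p₀ ≫ i).appTop r) = (x ≫ g).appTop r
    rw [← hX.w, ← h₀, Category.assoc, Scheme.Hom.comp_appTop a₀]
    rfl⟩
  have hD (k) : IsAffineOpen ((p₀ ≫ i) ⁻¹ᵁ V.basicOpen (r k)) :=
    (((isAffineOpen_top V).basicOpen (r k)).preimage_of_isOpenImmersion i (hri k)).preimage p₀
  have h₁ (k) : ∃ S : Finset Γ(T₀, ⊤), ∀ q, ∃ n : ℕ,
      r k ^ n • q ∈ Algebra.adjoin Γ(V, ⊤) (S : Set Γ(T₀, ⊤)) := by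
    set D := (p₀ ≫ i) ⁻¹ᵁ V.basicOpen (r k)
    let : Algebra Γ(V, ⊤) Γ(T₀, D) := ((p₀ ≫ i).appLE ⊤ D le_top).hom.toAlgebra
    let : Algebra Γ(T₀, ⊤) Γ(T₀, D) :=
      (T₀.presheaf.map (homOfLE le_top : D ⟶ ⊤).op).hom.toAlgebra
    have : IsScalarTower Γ(V, ⊤) Γ(T₀, ⊤) Γ(T₀, D) := .of_algebraMap_eq fun _ ↦ rfl
    have : Algebra.FiniteType Γ(V, ⊤) Γ(T₀, D) :=
      (p₀ ≫ i).finiteType_appLE (isAffineOpen_top V) (hD k) le_top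
    have : IsLocalization.Away (algebraMap Γ(V, ⊤) Γ(T₀, ⊤) (r k)) Γ(T₀, D) :=
      isLocalization_of_eq_basicOpen _ (Scheme.preimage_basicOpen_top (p₀ ≫ i) (r k))
    exact exists_finset_pow_smul_mem_adjoin (M := Γ(T₀, D)) (r k)
  have hx (k) := IsOpenImmersion.appTop_eq_pow_mul x (g.appTop (r k)) (by
    rw [← Scheme.preimage_basicOpen_top]
    exact (g.preimage_mono (hri k)).trans_eq (preimage_opensRange_of_isPullback hX))
  have hsmul (k n l) : r k ^ n • l = x.appTop (g.appTop (r k)) ^ n * l := by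
    rw [Algebra.smul_def, map_pow]
    have : algebraMap Γ(V, ⊤) Γ(XO, ⊤) (r k) = x.appTop (g.appTop (r k)) :=
      congr($(Scheme.Hom.comp_appTop x g) (r k))
    rw [this]
  obtain ⟨B, hB, hB₁, hB₂, hB₃⟩ := exists_fg_subalgebra_prod α β r h₁ (fun k l ↦ by
    obtain ⟨n, a, ha⟩ := (hx k).1 l
    exact ⟨n, a, ha.trans (hsmul k n l).symm⟩) (fun k a ha ↦ by
    obtain ⟨n, hn⟩ := (hx k).2 a ha
    exact ⟨n, by rw [Algebra.smul_def, map_pow]; exact hn⟩)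
  obtain ⟨T, _, ⟨e⟩⟩ : ∃ (T : Scheme.{u}) (_ : IsAffine T), Nonempty (Γ(T, ⊤) ≃+* B) :=
    ⟨Spec (.of B), inferInstance, ⟨(Scheme.ΓSpecIso _).commRingCatIsoToRingEquiv⟩⟩
  obtain ⟨a, ha⟩ := exists_appTop_eq (T := T) (X := X) (CommRingCat.ofHom
    (((RingHom.fst Γ(X, ⊤) Γ(T₀, ⊤)).comp B.val.toRingHom).comp e.toRingHom))
  obtain ⟨j, hj⟩ := exists_appTop_eq (T := T) (X := T₀) (CommRingCat.ofHom
    (((RingHom.snd Γ(X, ⊤) Γ(T₀, ⊤)).comp B.val.toRingHom).comp e.toRingHom))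
  obtain ⟨p, hp⟩ := exists_appTop_eq (T := V) (X := T) (CommRingCat.ofHom
    (e.symm.toRingHom.comp (algebraMap Γ(V, ⊤) B)))
  have ha' (t) : a.appTop t = (e t).1.1 := by rw [ha]; rfl
  have hj' (t) : j.appTop t = (e t).1.2 := by rw [hj]; rfl
  have hp' (t) : e (p.appTop t) = algebraMap Γ(V, ⊤) B t := by
    rw [hp]; exact e.apply_symm_apply _
  have hap : a ≫ p = g := ext_of_isAffine <| by
    ext t
    rw [Scheme.Hom.comp_appTop, CommRingCat.comp_apply, ha', hp']
    rfl
  have hjp : j ≫ p = p₀ ≫ i := ext_of_isAffine <| by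
    ext t
    rw [Scheme.Hom.comp_appTop, CommRingCat.comp_apply, hj', hp']
    rfl
  have haj : a₀ ≫ j = x ≫ a := ext_of_isAffine <| by
    ext t
    rw [Scheme.Hom.comp_appTop, Scheme.Hom.comp_appTop, CommRingCat.comp_apply,
      CommRingCat.comp_apply, hj', ha']
    exact (hB₁ _ (e t).2).symm
  have hj₁ (k) : IsIso (j ∣_ T.basicOpen (p.appTop (r k))) := by
    refine isIso_morphismRestrict_basicOpen j _ ?_ (fun q ↦ ?_) (fun b hb ↦ ?_)
    · rw [← Scheme.preimage_basicOpen_top, ← Scheme.Hom.comp_preimage, hjp]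
      exact hD k
    · obtain ⟨n, b, hb, h⟩ := hB₂ k q
      refine ⟨n, e.symm ⟨b, hb⟩, ?_⟩
      rw [hj', hj', hp', e.apply_symm_apply, h, Algebra.smul_def, map_pow]
      rfl
    · rw [hj'] at hb
      obtain ⟨n, hn⟩ := hB₃ k _ (e b).2 hb
      refine ⟨n, e.injective ?_⟩
      rw [map_mul, map_pow, hp', map_zero, ← map_pow, ← Algebra.smul_def]
      exact Subtype.ext hn
  have hT : p ⁻¹ᵁ i.opensRange = ⨆ k, T.basicOpen (p.appTop (r k)) := by
    rw [hr, Scheme.Hom.preimage_iSup]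
    simp only [Scheme.preimage_basicOpen_top]
  obtain ⟨_, hj₂⟩ := isOpenImmersion_of_isIso_morphismRestrict j _ (by
    rw [← hT, ← Scheme.Hom.comp_preimage, hjp, Scheme.Hom.comp_preimage,
      Scheme.Hom.preimage_opensRange]
    rfl) hj₁
  refine ⟨T, a, p, j, ‹_›, ?_, hap, ?_, haj⟩
  · rw [locallyOfFiniteType_iff_of_isAffine, hp]
    exact (RingHom.FiniteType.of_surjective e.symm.toRingHom e.symm.surjective).comp
      (RingHom.finiteType_algebraMap.mpr (B.fg_iff_finiteType.mp hB))
  · exact IsOpenImmersion.isPullback _ _ _ _ hjp (hT.trans hj₂.symm)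

end AlgebraicGeometry

namespace AlgebraicGeometry

namespace IsOpenSquare

variable {O W₁ W₂ W : Scheme.{u}} {i₁ : O ⟶ W₁} {i₂ : O ⟶ W₂} {j₁ : W₁ ⟶ W} {j₂ : W₂ ⟶ W}
  {X X₁ X₂ : Scheme.{u}} {g : X ⟶ W} {g₁ : X₁ ⟶ W₁} {g₂ : X₂ ⟶ W₂} {x₁ : X₁ ⟶ X} {x₂ : X₂ ⟶ X}

lemma exists_of_isPullback (h : IsOpenSquare i₁ i₂ j₁ j₂) (h₁ : IsPullback g₁ x₁ j₁ g)
    (h₂ : IsPullback g₂ x₂ j₂ g) : ∃ (U : Scheme.{u}) (u₁ : U ⟶ X₁) (u₂ : U ⟶ X₂) (v : U ⟶ O),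
    IsOpenSquare u₁ u₂ x₁ x₂ ∧ IsPullback v u₁ i₁ g₁ ∧ IsPullback v u₂ i₂ g₂ := by
  have := h.2; have := h.3
  have : IsOpenImmersion x₁ := MorphismProperty.of_isPullback h₁ inferInstance
  have : IsOpenImmersion x₂ := MorphismProperty.of_isPullback h₂ inferInstance
  have hs : IsOpenSquare (pullback.fst x₁ x₂) (pullback.snd x₁ x₂) x₁ x₂ := by
    refine of_sup_eq_top ?_
    rw [← preimage_opensRange_of_isPullback h₁, ← preimage_opensRange_of_isPullback h₂,
      ← Scheme.Hom.preimage_sup, h.4]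
    rfl
  let v : pullback x₁ x₂ ⟶ O := h.isPullback.lift (pullback.fst x₁ x₂ ≫ g₁)
    (pullback.snd x₁ x₂ ≫ g₂) (by
      rw [Category.assoc, Category.assoc, h₁.w, h₂.w, pullback.condition_assoc])
  refine ⟨_, _, _, v, hs, ?_, ?_⟩
  · refine .of_right ?_ (h.isPullback.lift_fst _ _ _) h.isPullback.flip
    rw [h₁.w, h.isPullback.lift_snd]
    exact hs.isPullback.flip.paste_horiz h₂
  · refine .of_right ?_ (h.isPullback.lift_snd _ _ _) h.isPullback
    rw [h₂.w, h.isPullback.lift_fst]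
    exact hs.isPullback.paste_horiz h₁

theorem exists_extension (h : IsOpenSquare i₁ i₂ j₁ j₂) [IsAffine W₂] [CompactSpace O]
    [IsAffineHom g] (h₁ : IsPullback g₁ x₁ j₁ g) {T₁ : Scheme.{u}} (a₁ : X₁ ⟶ T₁) (p₁ : T₁ ⟶ W₁)
    [IsAffineHom p₁] [LocallyOfFiniteType p₁] (e₁ : a₁ ≫ p₁ = g₁) :
    ∃ (T : Scheme.{u}) (a : X ⟶ T) (p : T ⟶ W) (j : T₁ ⟶ T), IsAffineHom p ∧
      LocallyOfFiniteType p ∧ a ≫ p = g ∧ IsPullback p₁ j j₁ p ∧ a₁ ≫ j = x₁ ≫ a := by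
  have := h.2; have := h.3
  have : IsOpenImmersion i₁ := MorphismProperty.of_isPullback h.isPullback.flip inferInstance
  have : IsOpenImmersion i₂ := MorphismProperty.of_isPullback h.isPullback inferInstance
  have h₂ := IsPullback.of_hasPullback j₂ g
  set X₂ := pullback j₂ g
  set g₂ : X₂ ⟶ W₂ := pullback.fst j₂ g
  set x₂ : X₂ ⟶ X := pullback.snd j₂ g
  have : IsAffineHom g₂ := MorphismProperty.of_isPullback h₂.flip inferInstance
  have : IsAffine X₂ := isAffine_of_isAffineHom g₂
  obtain ⟨U, u₁, u₂, v, hU, hv₁, hv₂⟩ := h.exists_of_isPullback h₁ h₂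
  have hN := IsPullback.of_hasPullback i₁ p₁
  set N := pullback i₁ p₁
  set q : N ⟶ O := pullback.fst i₁ p₁
  set t : N ⟶ T₁ := pullback.snd i₁ p₁
  have : IsAffineHom q := MorphismProperty.of_isPullback hN.flip inferInstance
  have : LocallyOfFiniteType q := MorphismProperty.of_isPullback hN.flip inferInstance
  have : IsOpenImmersion t := MorphismProperty.of_isPullback hN inferInstance
  let n : U ⟶ N := hN.lift v (u₁ ≫ a₁) (by rw [Category.assoc, e₁, hv₁.w])
  obtain ⟨T₂, a₂, p₂, j, _, _, e₂, hj, hn⟩ := exists_extension_of_isAffine hv₂ n q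
    (hN.lift_fst _ _ _)
  have : IsOpenImmersion j := MorphismProperty.of_isPullback hj inferInstance
  obtain ⟨T, k₁, k₂, hT⟩ := exists_of_isOpenImmersion t j
  obtain ⟨p, hp₁, hp₂⟩ := hT.exists_desc (p₁ ≫ j₁) (p₂ ≫ j₂) (by
    rw [← Category.assoc, ← Category.assoc, ← hN.w, ← hj.w, Category.assoc, h.isPullback.w,
      Category.assoc])
  obtain ⟨a, ha₁, ha₂⟩ := hU.exists_desc (a₁ ≫ k₁) (a₂ ≫ k₂) (by
    rw [← reassoc_of% hn, ← hT.isPullback.w, ← Category.assoc, ← hN.lift_snd v (u₁ ≫ a₁),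
      Category.assoc])
  have hpb₁ : IsPullback p₁ k₁ j₁ p := h.isPullback_left hT hp₁ hp₂ hj
  have hpb₂ : IsPullback p₂ k₂ j₂ p := h.symm.isPullback_left hT.symm hp₂ hp₁ hN
  refine ⟨T, a, p, k₁, ?_, ?_, hU.hom_ext ?_ ?_, hpb₁, ha₁.symm⟩
  · exact h.of_isZariskiLocalAtTarget @IsAffineHom hpb₁ hpb₂ inferInstance inferInstance
  · exact h.of_isZariskiLocalAtTarget @LocallyOfFiniteType hpb₁ hpb₂ inferInstance inferInstance
  · rw [reassoc_of% ha₁, hp₁, reassoc_of% e₁, h₁.w]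
  · rw [reassoc_of% ha₂, hp₂, reassoc_of% e₂, h₂.w]

end IsOpenSquare

/-- A finite type affine model of an affine morphism over a quasi-compact open of a qcqs scheme
extends to the whole scheme. -/
theorem exists_extension {W O X XO T₀ : Scheme.{u}} [CompactSpace W] [QuasiSeparatedSpace W]
    [CompactSpace O] {i : O ⟶ W} [IsOpenImmersion i] {g : X ⟶ W} [IsAffineHom g] {gO : XO ⟶ O}
    {x : XO ⟶ X} (hX : IsPullback gO x i g) (a₀ : XO ⟶ T₀) (p₀ : T₀ ⟶ O) [IsAffineHom p₀]
    [LocallyOfFiniteType p₀] (h₀ : a₀ ≫ p₀ = gO) :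
    ∃ (T : Scheme.{u}) (a : X ⟶ T) (p : T ⟶ W) (j : T₀ ⟶ T), IsAffineHom p ∧
      LocallyOfFiniteType p ∧ a ≫ p = g ∧ IsPullback p₀ j i p ∧ a₀ ≫ j = x ≫ a := by
  have key : ∃ (O' : Scheme.{u}) (l : O ⟶ O') (i' : O' ⟶ W) (_ : IsOpenImmersion i')
      (_ : CompactSpace O') (_ : l ≫ i' = i) (X' : Scheme.{u}) (g' : X' ⟶ O') (x' : X' ⟶ X)
      (_ : IsPullback g' x' i' g) (xl : XO ⟶ X') (_ : xl ≫ x' = x)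
      (T' : Scheme.{u}) (a' : X' ⟶ T') (p' : T' ⟶ O') (j' : T₀ ⟶ T') (_ : IsAffineHom p')
      (_ : LocallyOfFiniteType p') (_ : a' ≫ p' = g') (_ : IsPullback p₀ j' l p')
      (_ : a₀ ≫ j' = xl ≫ a'), i'.opensRange = i.opensRange ⊔ ⊤ := by
    refine compact_open_induction_on (P := fun M ↦ ∃ (O' : Scheme.{u}) (l : O ⟶ O') (i' : O' ⟶ W)
      (_ : IsOpenImmersion i')
      (_ : CompactSpace O') (_ : l ≫ i' = i) (X' : Scheme.{u}) (g' : X' ⟶ O') (x' : X' ⟶ X)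
      (_ : IsPullback g' x' i' g) (xl : XO ⟶ X') (_ : xl ≫ x' = x)
      (T' : Scheme.{u}) (a' : X' ⟶ T') (p' : T' ⟶ O') (j' : T₀ ⟶ T') (_ : IsAffineHom p')
      (_ : LocallyOfFiniteType p') (_ : a' ≫ p' = g') (_ : IsPullback p₀ j' l p')
      (_ : a₀ ≫ j' = xl ≫ a'), i'.opensRange = i.opensRange ⊔ M) ⊤ isCompact_univ ?_ ?_
    · exact ⟨O, 𝟙 O, i, ‹_›, ‹_›, Category.id_comp _, XO, gO, x, hX, 𝟙 _, Category.id_comp _,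
        T₀, a₀, p₀, 𝟙 _, ‹_›, ‹_›, h₀, .of_id_snd, by simp, by simp⟩
    · rintro M - V ⟨O', l, i', _, _, hl, X', g', x', hX', xl, hxl, T', a', p', j', _, _, h', hp', ha',
        hM⟩
      let O'' : W.Opens := i'.opensRange ⊔ V
      have hV : IsAffine V := V.2
      let j₁ : O' ⟶ O'' := IsOpenImmersion.lift O''.ι i' (by
        rw [Scheme.Opens.range_ι]
        exact fun _ h ↦ Or.inl h)
      let j₂ : V.1.toScheme ⟶ O'' := W.homOfLE le_sup_right
      have hj₁ : j₁ ≫ O''.ι = i' := IsOpenImmersion.lift_fac _ _ _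
      have : IsOpenImmersion (j₁ ≫ O''.ι) := hj₁ ▸ ‹_›
      have : IsOpenImmersion j₁ := .of_comp _ O''.ι
      have hs := IsOpenSquare.of_sup_eq_top (j₁ := j₁) (j₂ := j₂) (by
        refine top_le_iff.mp fun y _ ↦ ?_
        obtain ⟨z, hz⟩ | hz : y.1 ∈ i'.opensRange ∨ y.1 ∈ V.1 := y.2
        · refine Or.inl ⟨z, O''.ι.injective ?_⟩
          rw [← Scheme.Hom.comp_apply, hj₁]
          exact hz
        · refine Or.inr ⟨⟨y.1, hz⟩, O''.ι.injective ?_⟩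
          exact congr($(W.homOfLE_ι (le_sup_right : V.1 ≤ O'')) ⟨y.1, hz⟩))
      have : CompactSpace O'' := isCompact_iff_compactSpace.mp
        ((isCompact_range i'.continuous).union V.2.isCompact)
      have : QuasiSeparatedSpace O'' := quasiSeparatedSpace_of_quasiSeparated O''.ι
      have : QuasiCompact j₂ := inferInstance
      have : CompactSpace (pullback j₁ j₂ :) :=
        QuasiCompact.compactSpace_of_compactSpace (pullback.fst j₁ j₂)
      have : IsAffineHom (pullback.fst O''.ι g) :=
        MorphismProperty.of_isPullback (IsPullback.of_hasPullback O''.ι g).flip ‹_›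
      have h₃ : IsPullback g' (pullback.lift (g' ≫ j₁) x' (by rw [Category.assoc, hj₁, hX'.w]))
          j₁ (pullback.fst O''.ι g) := by
        refine .of_bot (v₂₁ := pullback.snd O''.ι g) ?_ (pullback.lift_fst _ _ _).symm
          (.of_hasPullback _ _)
        rwa [pullback.lift_snd, hj₁]
      obtain ⟨T, a, p, j, _, _, h₁, h₂, e⟩ := hs.exists_extension h₃ a' p' h'
      refine ⟨O'', l ≫ j₁, O''.ι, inferInstance, ‹_›, by rw [Category.assoc, hj₁, hl], _,
        pullback.fst O''.ι g, pullback.snd _ _, .of_hasPullback _ _, 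
        xl ≫ pullback.lift (g' ≫ j₁) x' (by rw [Category.assoc, hj₁, hX'.w]), ?_, T, a, p,
        j' ≫ j, ‹_›, ‹_›, h₁, hp'.paste_vert h₂, ?_, ?_⟩
      · rw [Category.assoc, pullback.lift_snd, hxl]
      · simp only [reassoc_of% ha', e, Category.assoc]
      · rw [Scheme.Opens.opensRange_ι, ← sup_assoc, ← hM]
  obtain ⟨O', l, i', _, _, hl, X', g', x', hX', xl, hxl, T, a, p, j, _, _, h, hp, ha, hM⟩ := key
  have : IsIso i' := isIso_of_isOpenImmersion_of_opensRange_eq_top i' (hM.trans (sup_top_eq _))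
  have : IsIso x' := MorphismProperty.of_isPullback (P := .isomorphisms Scheme) hX' ‹_›
  refine ⟨T, inv x' ≫ a, p ≫ i', j, inferInstance, inferInstance, ?_, ?_, ?_⟩
  · rw [Category.assoc, IsIso.inv_comp_eq, reassoc_of% h, hX'.w]
  · rw [← hl, ← Category.comp_id j]
    exact hp.paste_vert (.of_vert_isIso ⟨by simp⟩)
  · rw [ha, ← hxl]
    simp

end AlgebraicGeometry

namespace AlgebraicGeometry

/-- `X ⟶ T ⟶ W` is a factorisation of an affine morphism into a scheme-theoretically dominant
morphism followed by an affine morphism of finite type. -/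
structure IsAffineModel {X T W : Scheme.{u}} (a : X ⟶ T) (p : T ⟶ W) : Prop where
  isAffineHom_left : IsAffineHom a
  isAffineHom_right : IsAffineHom p
  locallyOfFiniteType : LocallyOfFiniteType p
  isSchemeTheoreticallyDominant : IsSchemeTheoreticallyDominant a

namespace IsAffineModel

variable {X T T' W : Scheme.{u}}

lemma comp {a : X ⟶ T} {p : T ⟶ W} (h : IsAffineModel a p) {b : X ⟶ T'} {q : T' ⟶ T}
    (h' : IsAffineModel b q) : IsAffineModel b (q ≫ p) := by
  obtain ⟨_, _, _, _⟩ := h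
  obtain ⟨_, _, _, _⟩ := h'
  exact ⟨‹_›, inferInstance, inferInstance, ‹_›⟩

lemma appLE_injective {a : X ⟶ T} {p : T ⟶ W} (h : IsAffineModel a p) {V : T.Opens}
    {U : X.Opens} (e : U ≤ a ⁻¹ᵁ V) (e' : U = a ⁻¹ᵁ V) : Function.Injective (a.appLE V U e) := by
  obtain ⟨_, _, _, _⟩ := h
  subst e'
  rw [Scheme.Hom.appLE_eq_app]
  exact a.app_injective V

lemma compactSpace {a : X ⟶ T} {p : T ⟶ W} (h : IsAffineModel a p) [CompactSpace W] :
    CompactSpace T := by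
  obtain ⟨_, _, _, _⟩ := h
  exact QuasiCompact.compactSpace_of_compactSpace p

lemma quasiSeparatedSpace {a : X ⟶ T} {p : T ⟶ W} (h : IsAffineModel a p)
    [QuasiSeparatedSpace W] : QuasiSeparatedSpace T := by
  obtain ⟨_, _, _, _⟩ := h
  exact quasiSeparatedSpace_of_quasiSeparated p

/-- Every factorisation through an affine morphism of finite type can be refined to a dominant
one. -/
lemma exists_of_comp (a : X ⟶ T) (p : T ⟶ W) [IsAffineHom (a ≫ p)] [IsAffineHom p]
    [LocallyOfFiniteType p] : ∃ (T' : Scheme.{u}) (b : X ⟶ T') (q : T' ⟶ T),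
      IsAffineModel b (q ≫ p) ∧ b ≫ q = a := by
  have : IsAffineHom a := .of_comp a p
  refine ⟨a.image, a.toImage, a.imageι, ⟨?_, inferInstance, inferInstance, ⟨?_⟩⟩,
    a.toImage_imageι⟩
  · have : IsAffineHom (a.toImage ≫ a.imageι) := by rwa [a.toImage_imageι]
    exact .of_comp _ a.imageι
  · refine Scheme.IdealSheafData.ext_of_iSup_eq_top
      (fun U : T.affineOpens ↦ ⟨a.imageι ⁻¹ᵁ U, U.2.preimage a.imageι⟩) ?_ fun U ↦ ?_
    · dsimp only
      rw [← Scheme.Hom.preimage_iSup, iSup_affineOpens_eq_top, Scheme.Hom.preimage_top]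
    · rw [Scheme.Hom.ker_apply]
      simpa using (RingHom.injective_iff_ker_eq_bot _).mp (a.toImage_app_injective U)

end IsAffineModel

lemma IsOpenImmersion.bijective_appLE {X Y : Scheme.{u}} (j : X ⟶ Y) [IsOpenImmersion j]
    {U : Y.Opens} (hU : U = j.opensRange) (e : ⊤ ≤ j ⁻¹ᵁ U) :
    Function.Bijective (j.appLE U ⊤ e) := by
  rw [← Scheme.Hom.image_top_eq_opensRange] at hU
  subst hU
  rw [← Scheme.Hom.appIso_hom']
  exact (ConcreteCategory.isIso_iff_bijective _).mp inferInstance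

lemma Scheme.Hom.appLE_appLE_apply {X Y Z : Scheme.{u}} (f : X ⟶ Y) (g : Y ⟶ Z) {h : X ⟶ Z}
    (e : f ≫ g = h) {U : Z.Opens} {V : Y.Opens} {W : X.Opens} (h₁ : W ≤ f ⁻¹ᵁ V) (h₂ : V ≤ g ⁻¹ᵁ U)
    (h₃ : W ≤ h ⁻¹ᵁ U) (t : Γ(Z, U)) :
    f.appLE V W h₁ (g.appLE U V h₂ t) = h.appLE U W h₃ t := by
  subst e
  exact congr($(Scheme.Hom.appLE_comp_appLE f g U V W h₂ h₁) t)

/-- Sections over the preimage of a quasi-compact open subset descend to a finite type affine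
model. -/
theorem exists_appLE_eq {X W : Scheme.{u}} [CompactSpace W] [QuasiSeparatedSpace W] (g : X ⟶ W)
    [hg : IsAffineHom g] (O : W.Opens) (hO : IsCompact (O : Set W)) (s : Γ(X, g ⁻¹ᵁ O)) :
    ∃ (T : Scheme.{u}) (a : X ⟶ T) (p : T ⟶ W), IsAffineModel a p ∧ a ≫ p = g ∧
      ∃ (e : g ⁻¹ᵁ O ≤ a ⁻¹ᵁ p ⁻¹ᵁ O) (t : Γ(T, p ⁻¹ᵁ O)), a.appLE _ _ e t = s := by
  have : CompactSpace O := isCompact_iff_compactSpace.mp hO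
  let x := (g ⁻¹ᵁ O).ι
  let a₀ : (g ⁻¹ᵁ O).toScheme ⟶ 𝔸(PUnit.{u + 1}; O) :=
    AffineSpace.homOfVector (g ∣_ O) fun _ ↦ (g ⁻¹ᵁ O).topIso.inv s
  obtain ⟨T, a, p, j, _, _, e, hp, ha⟩ := exists_extension (isPullback_morphismRestrict g O) a₀
    (𝔸(PUnit.{u + 1}; O) ↘ O.toScheme) (AffineSpace.homOfVector_over _ _)
  replace ha : a₀ ≫ j = x ≫ a := ha
  have : IsOpenImmersion j := MorphismProperty.of_isPullback hp inferInstance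
  have hj : p ⁻¹ᵁ O = j.opensRange := by
    rw [← preimage_opensRange_of_isPullback hp, Scheme.Opens.opensRange_ι]
  have hx : g ⁻¹ᵁ O = x.opensRange := (Scheme.Opens.opensRange_ι _).symm
  have hj' : ⊤ ≤ j ⁻¹ᵁ (p ⁻¹ᵁ O) := fun y _ ↦ hj ▸ ⟨y, rfl⟩
  have hx' : ⊤ ≤ x ⁻¹ᵁ (g ⁻¹ᵁ O) := fun y _ ↦ y.2
  have : IsAffineHom (a ≫ p) := e ▸ hg
  obtain ⟨T', b, q, hb, hq⟩ := IsAffineModel.exists_of_comp (W := W) a p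
  obtain ⟨t, ht⟩ := (IsOpenImmersion.bijective_appLE j hj hj').2 (AffineSpace.coord _ ⟨⟩)
  have ea : g ⁻¹ᵁ O ≤ a ⁻¹ᵁ p ⁻¹ᵁ O := by rw [← e]; rfl
  have eq : (q ≫ p) ⁻¹ᵁ O ≤ q ⁻¹ᵁ p ⁻¹ᵁ O := le_rfl
  have eb : g ⁻¹ᵁ O ≤ b ⁻¹ᵁ (q ≫ p) ⁻¹ᵁ O := by rw [← e, ← hq]; rfl
  refine ⟨T', b, q ≫ p, hb, by rw [reassoc_of% hq, e], eb, q.appLE (p ⁻¹ᵁ O) _ eq t, ?_⟩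
  apply (IsOpenImmersion.bijective_appLE x hx hx').1
  have hax : ⊤ ≤ (x ≫ a) ⁻¹ᵁ (p ⁻¹ᵁ O) := fun y hy ↦ ea (hx' hy)
  rw [Scheme.Hom.appLE_appLE_apply b q hq _ _ ea, Scheme.Hom.appLE_appLE_apply x a rfl _ _ hax,
    ← Scheme.Hom.appLE_appLE_apply a₀ j ha le_top hj', ht]
  rw [show a₀.appLE ⊤ ⊤ le_top = a₀.appTop from Scheme.Hom.appLE_eq_app a₀]
  refine (AffineSpace.homOfVector_appTop_coord _ _ _).trans ?_
  rw [Scheme.Opens.ι_appLE]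
  rfl

end AlgebraicGeometry

namespace AlgebraicGeometry

variable {X W : Scheme.{u}}

/-- Finitely many conditions on finite type affine models that can each be achieved, and that
are stable under refinement, can be achieved simultaneously. -/
lemma exists_isAffineModel_forall [CompactSpace W] [QuasiSeparatedSpace W] (g : X ⟶ W)
    [IsAffineHom g] {ι : Type*} [Finite ι]
    (P : ι → ∀ ⦃T : Scheme.{u}⦄ (_ : X ⟶ T) (_ : T ⟶ W), Prop)
    (hP : ∀ i ⦃T T' : Scheme.{u}⦄ (a : X ⟶ T) (p : T ⟶ W) (b : X ⟶ T') (q : T' ⟶ T), IsAffineHom q →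
      a ≫ p = g → b ≫ q = a → P i a p → P i b (q ≫ p))
    (h : ∀ i ⦃T : Scheme.{u}⦄ (a : X ⟶ T) (p : T ⟶ W), IsAffineModel a p → a ≫ p = g →
      ∃ (T' : Scheme.{u}) (b : X ⟶ T') (q : T' ⟶ T), IsAffineModel b q ∧ b ≫ q = a ∧
        P i b (q ≫ p)) :
    ∃ (T : Scheme.{u}) (a : X ⟶ T) (p : T ⟶ W), IsAffineModel a p ∧ a ≫ p = g ∧ ∀ i, P i a p := by
  classical
  have := Fintype.ofFinite ι
  suffices ∀ S : Finset ι, ∃ (T : Scheme.{u}) (a : X ⟶ T) (p : T ⟶ W), IsAffineModel a p ∧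
      a ≫ p = g ∧ ∀ i ∈ S, P i a p by simpa using this Finset.univ
  intro S
  induction S using Finset.induction with
  | empty =>
    have : IsAffineHom (g ≫ 𝟙 W) := by simpa
    obtain ⟨T, a, p, hp, e⟩ := IsAffineModel.exists_of_comp g (𝟙 W)
    exact ⟨T, a, p ≫ 𝟙 W, hp, by simpa, by simp⟩
  | insert i S _ ih =>
    obtain ⟨T, a, p, hp, e, H⟩ := ih
    obtain ⟨T', b, q, hq, e', H'⟩ := h i a p hp e
    refine ⟨T', b, q ≫ p, hp.comp hq, by rw [reassoc_of% e', e], fun j hj ↦ ?_⟩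
    obtain rfl | hj := Finset.mem_insert.mp hj
    exacts [H', hP j a p b q hq.isAffineHom_right e e' (H j hj)]

/-- Finitely many sections over preimages of quasi-compact open subsets descend to a finite type
affine model. -/
theorem exists_forall_appLE_eq [CompactSpace W] [QuasiSeparatedSpace W] (g : X ⟶ W)
    [IsAffineHom g] {ι : Type*} [Finite ι] (O : ι → W.Opens) (hO : ∀ i, IsCompact (O i : Set W))
    (U : ι → X.Opens) (hU : ∀ i, U i = g ⁻¹ᵁ O i) (s : ∀ i, Γ(X, U i)) :
    ∃ (T : Scheme.{u}) (a : X ⟶ T) (p : T ⟶ W), IsAffineModel a p ∧ a ≫ p = g ∧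
      ∀ i, ∃ (e : U i ≤ a ⁻¹ᵁ p ⁻¹ᵁ O i) (t : Γ(T, p ⁻¹ᵁ O i)), a.appLE _ _ e t = s i := by
  obtain rfl : U = fun i ↦ g ⁻¹ᵁ O i := funext hU
  refine exists_isAffineModel_forall g (fun i T a p ↦ ∃ (e : g ⁻¹ᵁ O i ≤ a ⁻¹ᵁ p ⁻¹ᵁ O i)
    (t : Γ(T, p ⁻¹ᵁ O i)), a.appLE _ _ e t = s i) ?_ ?_
  · rintro i T T' a p b q - rfl rfl ⟨e, t, ht⟩
    have e₁ : (q ≫ p) ⁻¹ᵁ O i ≤ q ⁻¹ᵁ p ⁻¹ᵁ O i := le_rfl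
    exact ⟨e, q.appLE _ _ e₁ t, (Scheme.Hom.appLE_appLE_apply b q rfl _ _ e t).trans ht⟩
  · rintro i T a p hp rfl
    have := hp.compactSpace
    have := hp.quasiSeparatedSpace
    obtain ⟨_, _, _, _⟩ := hp
    exact exists_appLE_eq a (p ⁻¹ᵁ O i) (QuasiCompact.isCompact_preimage _ (O i).2 (hO i)) (s i)

lemma exists_sum_mul_eq_one {A : Type*} [CommRing A] {S : Set A} (h : Ideal.span S = ⊤) :
    ∃ (n : ℕ) (c f : Fin n → A), (∀ i, f i ∈ S) ∧ ∑ i, c i * f i = 1 := by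
  obtain ⟨n, c, f, e⟩ := Submodule.mem_span_set'.mp
    (show (1 : A) ∈ Submodule.span A S from (Ideal.eq_top_iff_one _).mp h)
  exact ⟨n, c, fun i ↦ f i, fun i ↦ (f i).2, e⟩

lemma span_range_eq_top_of_sum_mul_eq_one {A : Type*} [CommRing A] {n : ℕ} {c f : Fin n → A}
    (h : ∑ i, c i * f i = 1) : Ideal.span (Set.range f) = ⊤ := by
  rw [Ideal.eq_top_iff_one, ← h]
  exact sum_mem fun i _ ↦ Ideal.mul_mem_left _ _ (Ideal.subset_span ⟨i, rfl⟩)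

/-- An inclusion of preimages in `X` of open subsets of `W` holds over some finite type affine
model. -/
theorem exists_preimage_le_of_isAffineOpen [CompactSpace W] [QuasiSeparatedSpace W] (g : X ⟶ W)
    [IsAffineHom g] {M N : W.Opens} (hM : IsAffineOpen M) (h : g ⁻¹ᵁ M ≤ g ⁻¹ᵁ N) :
    ∃ (T : Scheme.{u}) (a : X ⟶ T) (p : T ⟶ W), IsAffineModel a p ∧ a ≫ p = g ∧
      p ⁻¹ᵁ M ≤ p ⁻¹ᵁ N := by
  let S : Set Γ(X, g ⁻¹ᵁ M) := {s | ∃ m : Γ(W, M), W.basicOpen m ≤ N ∧ g.app M m = s}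
  have hS : Ideal.span S = ⊤ := by
    rw [← (hM.preimage g).self_le_iSup_basicOpen_iff]
    intro x hx
    obtain ⟨m, hm, hxm⟩ := hM.exists_basicOpen_le ⟨g x, h hx⟩ hx
    simp only [Opens.mem_iSup]
    refine ⟨⟨_, m, hm, rfl⟩, ?_⟩
    rw [← Scheme.preimage_basicOpen]
    exact hxm
  obtain ⟨n, c, f, hf, e⟩ := exists_sum_mul_eq_one hS
  choose m hm hmf using hf
  obtain ⟨T, a, p, hp, rfl, H⟩ := exists_forall_appLE_eq g (fun _ ↦ M) (fun _ ↦ hM.isCompact)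
    (fun _ ↦ g ⁻¹ᵁ M) (fun _ ↦ rfl) c
  choose _ t ht using H
  refine ⟨T, a, p, hp, rfl, ?_⟩
  have e₀ : (a ≫ p) ⁻¹ᵁ M ≤ a ⁻¹ᵁ p ⁻¹ᵁ M := le_rfl
  have e' : ∑ i, t i * p.appLE M (p ⁻¹ᵁ M) le_rfl (m i) = 1 := by
    apply hp.appLE_injective e₀ rfl
    rw [map_sum, map_one, ← e]
    refine Finset.sum_congr rfl fun i _ ↦ ?_
    rw [map_mul, ht, ← hmf, Scheme.Hom.appLE_appLE_apply a p rfl _ _ le_rfl,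
      Scheme.Hom.appLE_eq_app]
  rw [← iSup_basicOpen_of_span_eq_top _ _ (span_range_eq_top_of_sum_mul_eq_one e'), iSup_range]
  refine iSup_le fun i ↦ ?_
  rw [Scheme.basicOpen_appLE]
  exact fun x hx ↦ hm i hx.2

/-- Inclusions of preimages in `X` of quasi-compact open subsets of `W` hold over some finite type
affine model. -/
theorem exists_forall_preimage_le [CompactSpace W] [QuasiSeparatedSpace W] (g : X ⟶ W)
    [IsAffineHom g] {ι : Type*} [Finite ι] (M N : ι → W.Opens)
    (hM : ∀ i, IsCompact (M i : Set W)) (h : ∀ i, g ⁻¹ᵁ M i ≤ g ⁻¹ᵁ N i) :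
    ∃ (T : Scheme.{u}) (a : X ⟶ T) (p : T ⟶ W), IsAffineModel a p ∧ a ≫ p = g ∧
      ∀ i, p ⁻¹ᵁ M i ≤ p ⁻¹ᵁ N i := by
  choose S hS hMS using fun i ↦
    isCompact_iff_finite_and_eq_biUnion_affineOpens.mp (hM i)
  have (i : ι) : Finite (S i) := hS i
  have hSM (i : ι) (L : S i) : (L.1 : W.Opens) ≤ M i := fun x hx ↦ by
    rw [hMS i]
    exact Opens.mem_iSup.mpr ⟨L.1, Opens.mem_iSup.mpr ⟨L.2, hx⟩⟩
  have hP := exists_isAffineModel_forall g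
    (fun (i : Σ i, S i) T a p ↦ p ⁻¹ᵁ (i.2.1 : W.Opens) ≤ p ⁻¹ᵁ N i.1)
    (fun i T T' a p b q _ _ _ h x hx ↦ h hx) fun i T a p hp e ↦ by
      subst e
      have := hp.compactSpace
      have := hp.quasiSeparatedSpace
      obtain ⟨_, _, _, _⟩ := hp
      exact exists_preimage_le_of_isAffineOpen a (M := p ⁻¹ᵁ i.2.1) (N := p ⁻¹ᵁ N i.1)
        (i.2.1.2.preimage p) fun x hx ↦ h i.1 (hSM _ i.2 hx)
  obtain ⟨T, a, p, hp, e, H⟩ := hP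
  refine ⟨T, a, p, hp, e, fun i x hx ↦ ?_⟩
  have hx' : p x ∈ M i := hx
  rw [hMS i] at hx'
  obtain ⟨L, hx'⟩ := Opens.mem_iSup.mp hx'
  obtain ⟨hL, hxL⟩ := Opens.mem_iSup.mp hx'
  exact H ⟨i, L, hL⟩ hxL

/-- A finite type affine model can be chosen such that the preimage of an affine open subset
is affine, if the preimage in `X` is affine. -/
theorem exists_isAffineOpen_preimage [CompactSpace W] [QuasiSeparatedSpace W] (g : X ⟶ W)
    [IsAffineHom g] {O : W.Opens} (hO : IsCompact (O : Set W)) (h : IsAffineOpen (g ⁻¹ᵁ O)) :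
    ∃ (T : Scheme.{u}) (a : X ⟶ T) (p : T ⟶ W), IsAffineModel a p ∧ a ≫ p = g ∧
      IsAffineOpen (p ⁻¹ᵁ O) := by
  let S : Set Γ(X, g ⁻¹ᵁ O) := {s | ∃ L ≤ O, IsAffineOpen L ∧ X.basicOpen s ≤ g ⁻¹ᵁ L}
  have hS : Ideal.span S = ⊤ := by
    rw [← h.self_le_iSup_basicOpen_iff]
    intro x hx
    obtain ⟨_, ⟨L, hL, rfl⟩, hxL, hLO⟩ :=
      W.isBasis_affineOpens.exists_subset_of_mem_open (show g x ∈ O from hx) O.isOpen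
    obtain ⟨s, hs, hxs⟩ := h.exists_basicOpen_le (V := g ⁻¹ᵁ L) ⟨x, hxL⟩ hx
    simp only [Opens.mem_iSup]
    exact ⟨⟨s, L, hLO, hL, hs⟩, hxs⟩
  obtain ⟨n, c, f, hf, e⟩ := exists_sum_mul_eq_one hS
  choose L hLO hL hfL using hf
  obtain ⟨T, a, p, hp, rfl, H⟩ := exists_forall_appLE_eq g (fun _ : Fin n ⊕ Fin n ↦ O)
    (fun _ ↦ hO) (fun _ ↦ g ⁻¹ᵁ O) (fun _ ↦ rfl) (Sum.elim c f)
  choose _ t ht using H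
  have e₀ : (a ≫ p) ⁻¹ᵁ O ≤ a ⁻¹ᵁ p ⁻¹ᵁ O := le_rfl
  have e' : ∑ i, t (.inl i) * t (.inr i) = 1 := by
    apply hp.appLE_injective e₀ rfl
    rw [map_sum, map_one, ← e]
    refine Finset.sum_congr rfl fun i _ ↦ ?_
    rw [map_mul, ht, ht]
    rfl
  have := hp.compactSpace
  have := hp.quasiSeparatedSpace
  obtain ⟨_, _, _, _⟩ := id hp
  obtain ⟨T', b, q, hb, rfl, H⟩ := exists_forall_preimage_le a
    (fun i ↦ T.basicOpen (t (.inr i))) (fun i ↦ p ⁻¹ᵁ L i)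
    (fun i ↦ isCompact_basicOpen _ (QuasiCompact.isCompact_preimage _ O.isOpen hO) _) fun i x hx ↦ by
      apply hfL i
      rw [show f i = _ from (ht (.inr i)).symm, Scheme.basicOpen_appLE]
      exact ⟨T.basicOpen_le _ hx, hx⟩
  obtain ⟨_, _, _, _⟩ := id hb
  refine ⟨T', b, q ≫ p, hp.comp hb, rfl, ?_⟩
  have e₁ : (q ≫ p) ⁻¹ᵁ O ≤ q ⁻¹ᵁ p ⁻¹ᵁ O := le_rfl
  have e₂ : ∑ i, q.appLE _ _ e₁ (t (.inl i)) * q.appLE _ _ e₁ (t (.inr i)) = 1 := by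
    simp only [← map_mul, ← map_sum, e', map_one]
  refine isAffineOpen_of_isAffineOpen_basicOpen _ _ (span_range_eq_top_of_sum_mul_eq_one e₂) ?_
  rintro _ ⟨i, rfl⟩
  have hLi : (q ≫ p) ⁻¹ᵁ L i ≤ (q ≫ p) ⁻¹ᵁ O := fun x hx ↦ hLO i hx
  have := (((hL i).preimage (q ≫ p))).basicOpen
    (T'.presheaf.map (homOfLE hLi).op (q.appLE _ _ e₁ (t (.inr i))))
  rw [Scheme.basicOpen_res, inf_eq_right.mpr] at this
  · exact this
  · intro x hx
    rw [Scheme.basicOpen_appLE] at hx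
    exact H i hx.2

end AlgebraicGeometry

namespace AlgebraicGeometry

variable {X W : Scheme.{u}}

/-- A quasi-compact open subset of `X` descends to a finite type affine model. -/
theorem exists_isCompact_preimage_eq [CompactSpace W] [QuasiSeparatedSpace W] (g : X ⟶ W)
    [IsAffineHom g] {U : X.Opens} (hU : IsCompact (U : Set X)) :
    ∃ (T : Scheme.{u}) (a : X ⟶ T) (p : T ⟶ W), IsAffineModel a p ∧ a ≫ p = g ∧
      ∃ O : T.Opens, IsCompact (O : Set T) ∧ a ⁻¹ᵁ O = U := by
  have H (x : U) : ∃ (L : W.Opens) (s : Γ(X, g ⁻¹ᵁ L)), IsAffineOpen L ∧ X.basicOpen s ≤ U ∧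
      x.1 ∈ X.basicOpen s := by
    obtain ⟨_, ⟨L, hL, rfl⟩, hxL, -⟩ :=
      W.isBasis_affineOpens.exists_subset_of_mem_open (Set.mem_univ (g x.1)) isOpen_univ
    obtain ⟨s, hs, hxs⟩ := (hL.preimage g).exists_basicOpen_le x hxL
    exact ⟨L, s, hL, hs, hxs⟩
  choose L s hL hs hxs using H
  obtain ⟨I, hI⟩ := hU.elim_finite_subcover (fun x ↦ (X.basicOpen (s x) : Set X))
    (fun x ↦ (X.basicOpen (s x)).isOpen) fun x hx ↦ Set.mem_iUnion.mpr ⟨⟨x, hx⟩, hxs _⟩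
  obtain ⟨T, a, p, hp, e, H⟩ := exists_forall_appLE_eq g (fun i : I ↦ L i)
    (fun i ↦ (hL i).isCompact) (fun i ↦ g ⁻¹ᵁ L i) (fun _ ↦ rfl) fun i ↦ s i
  choose _ t ht using H
  obtain ⟨_, _, _, _⟩ := id hp
  refine ⟨T, a, p, hp, e, ⨆ i, T.basicOpen (t i), ?_, ?_⟩
  · rw [Opens.coe_iSup]
    exact isCompact_iUnion fun i ↦
      isCompact_basicOpen _ (((hL i).preimage p).isCompact) _
  · have key (i : I) : a ⁻¹ᵁ T.basicOpen (t i) = X.basicOpen (s i) := by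
      rw [← ht, Scheme.basicOpen_appLE, eq_comm, inf_eq_right]
      subst e
      exact fun x hx ↦ T.basicOpen_le _ hx
    rw [Scheme.Hom.preimage_iSup]
    simp only [key]
    refine le_antisymm (iSup_le fun i ↦ hs i) fun x hx ↦ ?_
    obtain ⟨i, hi, hxi⟩ := Set.mem_iUnion₂.mp (hI hx)
    exact Opens.mem_iSup.mpr ⟨⟨i, hi⟩, hxi⟩

/-- A finite type affine model can be chosen to be affine over `Q` if `X` is affine over `Q`. -/
theorem exists_isAffineHom_comp {Q : Scheme.{u}} [CompactSpace W] [QuasiSeparatedSpace W]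
    [CompactSpace Q] [QuasiSeparatedSpace Q] (g : X ⟶ W) (q : W ⟶ Q) [IsAffineHom g]
    [IsAffineHom (g ≫ q)] :
    ∃ (T : Scheme.{u}) (a : X ⟶ T) (p : T ⟶ W), IsAffineModel a p ∧ a ≫ p = g ∧
      IsAffineHom (p ≫ q) := by
  obtain ⟨S, hS, hS'⟩ := isCompact_iff_finite_and_eq_biUnion_affineOpens.mp
    (show IsCompact ((⊤ : Q.Opens) : Set Q) from isCompact_univ)
  have : Finite S := hS
  have hP := exists_isAffineModel_forall g
    (fun (V : S) T a p ↦ IsAffineOpen (p ⁻¹ᵁ q ⁻¹ᵁ (V : Q.affineOpens).1))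
    (fun i T T' a p b r _ _ _ h ↦ h.preimage r) fun V T a p hp e ↦ by
      subst e
      have := hp.compactSpace
      have := hp.quasiSeparatedSpace
      obtain ⟨_, _, _, _⟩ := hp
      exact exists_isAffineOpen_preimage a (O := p ⁻¹ᵁ q ⁻¹ᵁ V.1.1)
        (QuasiCompact.isCompact_preimage _ ((q ⁻¹ᵁ V.1.1).isOpen)
          (QuasiCompact.isCompact_preimage _ V.1.1.isOpen V.1.2.isCompact))
        (V.1.2.preimage ((a ≫ p) ≫ q))
  obtain ⟨T, a, p, hp, e, H⟩ := hP
  refine ⟨T, a, p, hp, e, isAffineHom_of_forall_exists_isAffineOpen _ fun x ↦ ?_⟩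
  have hx : x ∈ (⊤ : Q.Opens) := trivial
  rw [hS'] at hx
  obtain ⟨V, hx⟩ := Opens.mem_iSup.mp hx
  obtain ⟨hV, hx⟩ := Opens.mem_iSup.mp hx
  exact ⟨V, hx, V.2, H ⟨V, hV⟩⟩

end AlgebraicGeometry

namespace AlgebraicGeometry

instance : IsZariskiLocalAtSource (@LocallyOfFiniteType : MorphismProperty Scheme.{u}) :=
  HasRingHomProperty.instIsZariskiLocalAtSource (P := @LocallyOfFiniteType)
    (Q := RingHom.FiniteType)

namespace IsOpenSquare

variable {XU X₁ X₂ X W₁ W₂ O₁ O₂ Y : Scheme.{u}} {u₁ : XU ⟶ X₁} {u₂ : XU ⟶ X₂} {x₁ : X₁ ⟶ X}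
  {x₂ : X₂ ⟶ X}

/-- Factorisations on two open pieces glue if their restrictions to the intersection factor
through a common scheme. -/
lemma exists_factorisation_of_isPullback [QuasiSeparatedSpace Y] (h : IsOpenSquare u₁ u₂ x₁ x₂)
    {i₁ : O₁ ⟶ W₁} {i₂ : O₂ ⟶ W₂}
    [IsOpenImmersion i₁] [IsOpenImmersion i₂] [CompactSpace O₁] [CompactSpace O₂]
    [CompactSpace W₁] [QuasiSeparatedSpace W₁] [CompactSpace W₂] [QuasiSeparatedSpace W₂]
    {f : X ⟶ Y} {g₁ : X₁ ⟶ W₁} {h₁ : W₁ ⟶ Y} {g₂ : X₂ ⟶ W₂} {h₂ : W₂ ⟶ Y}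
    (e₁ : g₁ ≫ h₁ = x₁ ≫ f) (e₂ : g₂ ≫ h₂ = x₂ ≫ f) {c₁ : XU ⟶ O₁} {c₂ : XU ⟶ O₂}
    (hc₁ : IsPullback c₁ u₁ i₁ g₁) (hc₂ : IsPullback c₂ u₂ i₂ g₂) [IsAffineHom g₁]
    [IsAffineHom g₂] [LocallyOfFiniteType h₁] [LocallyOfFiniteType h₂] [IsSeparated h₂] :
    ∃ (W : Scheme.{u}) (g : X ⟶ W) (k : W ⟶ Y), CompactSpace W ∧ QuasiSeparatedSpace W ∧
      IsAffineHom g ∧ LocallyOfFiniteType k ∧ g ≫ k = f := by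
  have : QuasiSeparatedSpace O₁ := quasiSeparatedSpace_of_quasiSeparated i₁
  have : QuasiSeparatedSpace O₂ := quasiSeparatedSpace_of_quasiSeparated i₂
  let P := pullback (i₁ ≫ h₁) (i₂ ≫ h₂)
  have : CompactSpace P :=
    QuasiCompact.compactSpace_of_compactSpace (pullback.fst (i₁ ≫ h₁) (i₂ ≫ h₂))
  have : QuasiSeparatedSpace P :=
    quasiSeparatedSpace_of_quasiSeparated (pullback.fst (i₁ ≫ h₁) (i₂ ≫ h₂))
  have : IsAffineHom c₁ := MorphismProperty.of_isPullback hc₁.flip inferInstance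
  have : IsAffineHom c₂ := MorphismProperty.of_isPullback hc₂.flip inferInstance
  have ec : c₁ ≫ i₁ ≫ h₁ = c₂ ≫ i₂ ≫ h₂ := by
    rw [hc₁.w_assoc, hc₂.w_assoc, e₁, e₂, h.isPullback.w_assoc]
  let c : XU ⟶ P := pullback.lift c₁ c₂ ec
  have hcf : c ≫ pullback.fst (i₁ ≫ h₁) (i₂ ≫ h₂) = c₁ := pullback.lift_fst _ _ _
  have hcs : c ≫ pullback.snd (i₁ ≫ h₁) (i₂ ≫ h₂) = c₂ := pullback.lift_snd _ _ _
  have : IsAffineHom (c ≫ pullback.fst (i₁ ≫ h₁) (i₂ ≫ h₂)) := by rwa [hcf]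
  have : IsAffineHom c := .of_comp c (pullback.fst (i₁ ≫ h₁) (i₂ ≫ h₂))
  obtain ⟨T, a, p, hp, ea, _⟩ := exists_isAffineHom_comp c (pullback.fst (i₁ ≫ h₁) (i₂ ≫ h₂))
  have := hp.compactSpace
  have := hp.quasiSeparatedSpace
  have eac : a ≫ p ≫ pullback.snd (i₁ ≫ h₁) (i₂ ≫ h₂) = c₂ := by rw [reassoc_of% ea, hcs]
  obtain ⟨_, _, _, _⟩ := hp
  have : IsAffineHom (a ≫ p ≫ pullback.snd (i₁ ≫ h₁) (i₂ ≫ h₂)) := by rwa [eac]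
  obtain ⟨N, b, r, hr, eb, hr'⟩ :=
    exists_isAffineHom_comp a (p ≫ pullback.snd (i₁ ≫ h₁) (i₂ ≫ h₂))
  obtain ⟨_, _, _, _⟩ := hr
  let n₁ := r ≫ p ≫ pullback.fst (i₁ ≫ h₁) (i₂ ≫ h₂)
  let n₂ := r ≫ p ≫ pullback.snd (i₁ ≫ h₁) (i₂ ≫ h₂)
  have hn₁ : b ≫ n₁ = c₁ := by simp only [n₁, reassoc_of% eb, reassoc_of% ea, hcf]
  have hn₂ : b ≫ n₂ = c₂ := by simp only [n₂, reassoc_of% eb, reassoc_of% ea, hcs]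
  have hn : n₁ ≫ i₁ ≫ h₁ = n₂ ≫ i₂ ≫ h₂ := by
    simp only [n₁, n₂, Category.assoc, pullback.condition]
  have : IsAffineHom n₁ := inferInstance
  have : IsAffineHom n₂ := hr'
  have : LocallyOfFiniteType n₁ := inferInstance
  have : LocallyOfFiniteType n₂ := inferInstance
  clear_value n₁ n₂
  obtain ⟨T₁, a₁, p₁, j₁, _, _, ea₁, hj₁, eb₁⟩ := AlgebraicGeometry.exists_extension hc₁ b n₁ hn₁
  obtain ⟨T₂, a₂, p₂, j₂, _, _, ea₂, hj₂, eb₂⟩ := AlgebraicGeometry.exists_extension hc₂ b n₂ hn₂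
  have : IsOpenImmersion j₁ := MorphismProperty.of_isPullback hj₁ inferInstance
  have : IsOpenImmersion j₂ := MorphismProperty.of_isPullback hj₂ inferInstance
  obtain ⟨W, k₁, k₂, hk⟩ := exists_of_isOpenImmersion j₁ j₂
  obtain ⟨g, hg₁, hg₂⟩ := h.exists_desc (a₁ ≫ k₁) (a₂ ≫ k₂) (by
    rw [← reassoc_of% eb₁, ← reassoc_of% eb₂, hk.isPullback.w])
  obtain ⟨k, hk₁, hk₂⟩ := hk.exists_desc (p₁ ≫ h₁) (p₂ ≫ h₂) (by
    rw [← hj₁.w_assoc, ← hj₂.w_assoc, hn])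
  have : IsAffineHom (a₁ ≫ p₁) := by rwa [ea₁]
  have : IsAffineHom (a₂ ≫ p₂) := by rwa [ea₂]
  have : IsAffineHom a₁ := .of_comp a₁ p₁
  have : IsAffineHom a₂ := .of_comp a₂ p₂
  have : CompactSpace T₁ := QuasiCompact.compactSpace_of_compactSpace p₁
  have : CompactSpace T₂ := QuasiCompact.compactSpace_of_compactSpace p₂
  have : QuasiSeparatedSpace T₁ := quasiSeparatedSpace_of_quasiSeparated p₁
  have : QuasiSeparatedSpace T₂ := quasiSeparatedSpace_of_quasiSeparated p₂
  have : CompactSpace N := QuasiCompact.compactSpace_of_compactSpace n₁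
  refine ⟨W, g, k, hk.compactSpace, hk.quasiSeparatedSpace, ?_, ?_, ?_⟩
  · have hb₁ : IsPullback b u₁ j₁ a₁ :=
      .of_right (by rwa [hn₁, ea₁]) eb₁ hj₁
    have hb₂ : IsPullback b u₂ j₂ a₂ :=
      .of_right (by rwa [hn₂, ea₂]) eb₂ hj₂
    exact hk.of_isZariskiLocalAtTarget @IsAffineHom (hk.isPullback_left h hg₁ hg₂ hb₂)
      (hk.symm.isPullback_left h.symm hg₂ hg₁ hb₁) inferInstance inferInstance
  · have := hk.2
    have := hk.3
    refine IsZariskiLocalAtSource.of_openCover (Scheme.openCoverOfPair k₁ k₂ hk.4) ?_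
    rintro (_ | _)
    · change LocallyOfFiniteType (k₂ ≫ k)
      rw [hk₂]
      infer_instance
    · change LocallyOfFiniteType (k₁ ≫ k)
      rw [hk₁]
      infer_instance
  · refine h.hom_ext ?_ ?_
    · rw [reassoc_of% hg₁, hk₁, reassoc_of% ea₁, e₁]
    · rw [reassoc_of% hg₂, hk₂, reassoc_of% ea₂, e₂]

/-- Factorisations on two open pieces into an affine morphism and a morphism of finite type glue,
up to refinement. -/
theorem exists_factorisation [QuasiSeparatedSpace Y] (h : IsOpenSquare u₁ u₂ x₁ x₂)
    [IsOpenImmersion u₁] [IsOpenImmersion u₂] [CompactSpace XU]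
    [CompactSpace W₁] [QuasiSeparatedSpace W₁] [CompactSpace W₂] [QuasiSeparatedSpace W₂]
    {f : X ⟶ Y} (g₁ : X₁ ⟶ W₁) (h₁ : W₁ ⟶ Y) (g₂ : X₂ ⟶ W₂) (h₂ : W₂ ⟶ Y)
    (e₁ : g₁ ≫ h₁ = x₁ ≫ f) (e₂ : g₂ ≫ h₂ = x₂ ≫ f) [IsAffineHom g₁]
    [IsAffineHom g₂] [LocallyOfFiniteType h₁] [LocallyOfFiniteType h₂] [IsSeparated h₂] :
    ∃ (W : Scheme.{u}) (g : X ⟶ W) (k : W ⟶ Y), CompactSpace W ∧ QuasiSeparatedSpace W ∧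
      IsAffineHom g ∧ LocallyOfFiniteType k ∧ g ≫ k = f := by
  have key {V U W : Scheme.{u}} [CompactSpace U] (u : U ⟶ V) [IsOpenImmersion u] (g : V ⟶ W)
      [IsAffineHom g] [CompactSpace W] [QuasiSeparatedSpace W] :
      ∃ (T : Scheme.{u}) (a : V ⟶ T) (p : T ⟶ W), IsAffineModel a p ∧ a ≫ p = g ∧
        ∃ (O : Scheme.{u}) (i : O ⟶ T) (c : U ⟶ O), IsOpenImmersion i ∧ CompactSpace O ∧
          IsPullback c u i a := by
    obtain ⟨T, a, p, hp, e, O, hO, ha⟩ := exists_isCompact_preimage_eq g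
      (U := u.opensRange) (isCompact_range u.continuous)
    have : Set.range (u ≫ a) ⊆ Set.range O.ι := by
      rw [Scheme.Opens.range_ι]
      rintro _ ⟨y, rfl⟩
      have : u y ∈ a ⁻¹ᵁ O := ha ▸ ⟨y, rfl⟩
      simpa
    refine ⟨T, a, p, hp, e, O, O.ι, IsOpenImmersion.lift O.ι (u ≫ a) this, inferInstance,
      isCompact_iff_compactSpace.mp hO, ?_⟩
    refine IsOpenImmersion.isPullback _ _ _ _ (IsOpenImmersion.lift_fac _ _ _).symm ?_
    rw [Scheme.Opens.opensRange_ι, ha]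
  obtain ⟨T₁, a₁, p₁, hp₁, ea₁, O₁, i₁, c₁, _, _, hc₁⟩ := key u₁ g₁
  obtain ⟨T₂, a₂, p₂, hp₂, ea₂, O₂, i₂, c₂, _, _, hc₂⟩ := key u₂ g₂
  have := hp₁.compactSpace
  have := hp₁.quasiSeparatedSpace
  have := hp₂.compactSpace
  have := hp₂.quasiSeparatedSpace
  obtain ⟨_, _, _, _⟩ := hp₁
  obtain ⟨_, _, _, _⟩ := hp₂
  exact h.exists_factorisation_of_isPullback (f := f) (h₁ := p₁ ≫ h₁) (h₂ := p₂ ≫ h₂)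
    (by rw [reassoc_of% ea₁, e₁]) (by rw [reassoc_of% ea₂, e₂]) hc₁ hc₂

end IsOpenSquare

end AlgebraicGeometry

namespace AlgebraicGeometry

/-- A morphism between quasi-compact quasi-separated schemes is the composition of an affine
morphism and a morphism of finite type. -/
theorem exists_isAffineHom_comp_locallyOfFiniteType {X Y : Scheme.{u}} (f : X ⟶ Y)
    [CompactSpace X] [QuasiSeparatedSpace X] [QuasiSeparatedSpace Y] :
    ∃ (W : Scheme.{u}) (g : X ⟶ W) (k : W ⟶ Y), CompactSpace W ∧ QuasiSeparatedSpace W ∧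
      IsAffineHom g ∧ LocallyOfFiniteType k ∧ g ≫ k = f := by
  let P (M : X.Opens) : Prop := ∃ (W : Scheme.{u}) (g : M.toScheme ⟶ W) (k : W ⟶ Y),
    CompactSpace W ∧ QuasiSeparatedSpace W ∧ IsAffineHom g ∧ LocallyOfFiniteType k ∧
      g ≫ k = M.ι ≫ f
  have hbot : P ⊥ := by
    have : IsEmpty (⊥ : X.Opens).toScheme := ⟨fun x ↦ x.2⟩
    have : IsOpenImmersion ((⊥ : X.Opens).ι ≫ f) := inferInstance
    exact ⟨_, 𝟙 _, (⊥ : X.Opens).ι ≫ f, inferInstance, inferInstance, inferInstance, inferInstance,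
      Category.id_comp _⟩
  have hsup (M V : X.Opens) (L : Y.Opens) (hM : IsCompact (M : Set X)) (h : P M)
      (hV : IsAffineOpen V) (hL : IsAffineOpen L) (hVL : V ≤ f ⁻¹ᵁ L) : P (M ⊔ V) := by
    obtain ⟨W, g, k, _, _, _, _, e⟩ := h
    have : IsAffine V := hV
    have : IsAffine L := hL
    have : CompactSpace M := isCompact_iff_compactSpace.mp hM
    let x₁ := X.homOfLE (le_sup_left : M ≤ M ⊔ V)
    let x₂ := X.homOfLE (le_sup_right : V ≤ M ⊔ V)
    have hx₁ : x₁ ≫ (M ⊔ V).ι = M.ι := X.homOfLE_ι _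
    have hx₂ : x₂ ≫ (M ⊔ V).ι = V.ι := X.homOfLE_ι _
    have hs : x₁.opensRange ⊔ x₂.opensRange = ⊤ := by
      refine eq_top_iff.mpr ?_
      rintro ⟨x, hx | hx⟩ -
      · refine Or.inl ⟨⟨x, hx⟩, (M ⊔ V).ι.isOpenEmbedding.injective congr($hx₁ ⟨x, hx⟩)⟩
      · refine Or.inr ⟨⟨x, hx⟩, (M ⊔ V).ι.isOpenEmbedding.injective congr($hx₂ ⟨x, hx⟩)⟩
    have : QuasiSeparatedSpace (M ⊔ V : X.Opens) := quasiSeparatedSpace_of_quasiSeparated (M ⊔ V).ι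
    have : CompactSpace (pullback x₁ x₂ : Scheme.{u}) :=
      QuasiCompact.compactSpace_of_compactSpace (pullback.fst x₁ x₂)
    have hr : Set.range (V.ι ≫ f) ⊆ Set.range L.ι := by
      rw [Scheme.Opens.range_ι]
      rintro _ ⟨y, rfl⟩
      exact hVL y.2
    exact (IsOpenSquare.of_sup_eq_top hs).exists_factorisation g k
      (IsOpenImmersion.lift L.ι (V.ι ≫ f) hr) L.ι
      (by rw [e, reassoc_of% hx₁])
      (by rw [IsOpenImmersion.lift_fac, reassoc_of% hx₂])
  have H (x : X) : ∃ (V : X.Opens) (L : Y.Opens), x ∈ V ∧ IsAffineOpen V ∧ IsAffineOpen L ∧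
      V ≤ f ⁻¹ᵁ L := by
    obtain ⟨_, ⟨L, hL, rfl⟩, hxL, -⟩ :=
      Y.isBasis_affineOpens.exists_subset_of_mem_open (Set.mem_univ (f x)) isOpen_univ
    obtain ⟨_, ⟨V, hV, rfl⟩, hxV, hVL⟩ :=
      X.isBasis_affineOpens.exists_subset_of_mem_open (show x ∈ f ⁻¹ᵁ L from hxL)
        (f ⁻¹ᵁ L).isOpen
    exact ⟨V, L, hxV, hV, hL, hVL⟩
  choose V L hxV hV hL hVL using H
  obtain ⟨I, hI⟩ := isCompact_univ.elim_finite_subcover (fun x ↦ (V x : Set X))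
    (fun x ↦ (V x).isOpen) fun x _ ↦ Set.mem_iUnion.mpr ⟨x, hxV x⟩
  have htop : P ⊤ := by
    have hI' : I.sup V = ⊤ := by
      refine eq_top_iff.mpr fun x hx ↦ ?_
      obtain ⟨i, hi, hxi⟩ := Set.mem_iUnion₂.mp (hI hx)
      exact Finset.le_sup (f := V) hi hxi
    rw [← hI']
    suffices ∀ S : Finset X, IsCompact ((S.sup V : X.Opens) : Set X) ∧ P (S.sup V) from (this I).2
    intro S
    classical
    induction S using Finset.induction with
    | empty => exact ⟨by simp, by simpa using hbot⟩
    | insert i S _ ih =>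
      rw [Finset.sup_insert, sup_comm]
      exact ⟨ih.1.union (hV i).isCompact, hsup _ _ (L i) ih.1 ih.2 (hV i) (hL i) (hVL i)⟩
  obtain ⟨W, g, k, _, _, _, _, e⟩ := htop
  refine ⟨W, X.topIso.inv ≫ g, k, ‹_›, ‹_›, inferInstance, ‹_›, ?_⟩
  rw [Category.assoc, e, Scheme.toIso_inv_ι_assoc]

end AlgebraicGeometry

lemma CommRingCat.exists_sum_of_isPushout {A B C D : CommRingCat.{u}} {f : A ⟶ B} {g : A ⟶ C}
    {inl : B ⟶ D} {inr : C ⟶ D} (h : IsPushout f g inl inr) (d : D) :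
    ∃ (n : ℕ) (b : Fin n → B) (c : Fin n → C), ∑ i, inl (b i) * inr (c i) = d := by
  algebraize [f.hom, g.hom, inl.hom, inr.hom, (inl.hom.comp f.hom)]
  have : IsScalarTower A C D := .of_algebraMap_eq' congr(($h.w).hom)
  have h' : Algebra.IsPushout A B C D := (CommRingCat.isPushout_iff_isPushout).mp h
  refine h'.out.inductionOn d _ ?_ ?_ ?_ ?_
  · exact ⟨0, Fin.elim0, Fin.elim0, by simp⟩
  · exact fun c ↦ ⟨1, fun _ ↦ 1, fun _ ↦ c, by simp; rfl⟩
  · rintro b _ ⟨n, x, y, rfl⟩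
    refine ⟨n, fun i ↦ b * x i, y, ?_⟩
    rw [Algebra.smul_def, Finset.mul_sum]
    simp only [map_mul, mul_assoc]
    rfl
  · rintro _ _ ⟨n, x, y, rfl⟩ ⟨n', x', y', rfl⟩
    exact ⟨n + n', Fin.append x x', Fin.append y y', by simp [Fin.sum_univ_add]⟩

namespace AlgebraicGeometry

/-- The sections over an affine open subset of a fibre product are sums of products of sections on
the factors. -/
lemma isAffineOpen_and_exists_sum_of_isPullback {P X Y S : Scheme.{u}} {fst : P ⟶ X}
    {snd : P ⟶ Y} {f : X ⟶ S} {g : Y ⟶ S} (H : IsPullback fst snd f g) {U : X.Opens} {V : Y.Opens}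
    {L : S.Opens} (hU : IsAffineOpen U) (hV : IsAffineOpen V) (hL : IsAffineOpen L)
    (hUL : U ≤ f ⁻¹ᵁ L) (hVL : V ≤ g ⁻¹ᵁ L) {D : P.Opens} (hD : D = fst ⁻¹ᵁ U ⊓ snd ⁻¹ᵁ V)
    (hDU : D ≤ fst ⁻¹ᵁ U) (hDV : D ≤ snd ⁻¹ᵁ V) :
    IsAffineOpen D ∧ ∀ t : Γ(P, D), ∃ (n : ℕ) (a : Fin n → Γ(X, U)) (b : Fin n → Γ(Y, V)),
      ∑ i, fst.appLE U D hDU (a i) * snd.appLE V D hDV (b i) = t := by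
  have : IsAffine U := hU
  have : IsAffine V := hV
  have : IsAffine L := hL
  let f' : U.toScheme ⟶ L := f.resLE _ _ hUL
  let g' : V.toScheme ⟶ L := g.resLE _ _ hVL
  let p : pullback f' g' ⟶ P := pullback.map f' g' f g U.ι V.ι L.ι (by simp [f']) (by simp [g']) ≫
    H.isoPullback.inv
  have hpf : p ≫ fst = pullback.fst f' g' ≫ U.ι := by
    simp only [p, Category.assoc, H.isoPullback_inv_fst]
    exact pullback.lift_fst _ _ _
  have hps : p ≫ snd = pullback.snd f' g' ≫ V.ι := by
    simp only [p, Category.assoc, H.isoPullback_inv_snd]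
    exact pullback.lift_snd _ _ _
  have hDp : D = p.opensRange := by
    subst hD
    apply le_antisymm
    · rintro z ⟨hz, hz'⟩
      have : H.isoPullback.hom z ∈ Set.range (pullback.map f' g' f g U.ι V.ι L.ι
          (by simp [f']) (by simp [g'])) := by
        rw [Scheme.Pullback.range_map, Scheme.Opens.range_ι, Scheme.Opens.range_ι]
        refine ⟨?_, ?_⟩
        · simpa [← Scheme.Hom.comp_apply] using hz
        · simpa [← Scheme.Hom.comp_apply] using hz'
      obtain ⟨y, hy⟩ := this
      refine ⟨y, ?_⟩
      rw [Scheme.Hom.comp_apply, hy, ← Scheme.Hom.comp_apply, Iso.hom_inv_id]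
      rfl
    · rintro _ ⟨y, rfl⟩
      refine ⟨?_, ?_⟩
      · change fst (p y) ∈ U
        rw [← Scheme.Hom.comp_apply, hpf]
        exact (pullback.fst f' g' y).2
      · change snd (p y) ∈ V
        rw [← Scheme.Hom.comp_apply, hps]
        exact (pullback.snd f' g' y).2
  refine ⟨hDp ▸ isAffineOpen_opensRange p, fun t ↦ ?_⟩
  have hp : ⊤ ≤ p ⁻¹ᵁ D := fun y _ ↦ hDp ▸ ⟨y, rfl⟩
  have hUι : ⊤ ≤ U.ι ⁻¹ᵁ U := fun y _ ↦ y.2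
  have hVι : ⊤ ≤ V.ι ⁻¹ᵁ V := fun y _ ↦ y.2
  obtain ⟨n, a, b, e⟩ := CommRingCat.exists_sum_of_isPushout
    (isPushout_appTop_of_isPullback (.of_hasPullback f' g')) (p.appLE D ⊤ hp t)
  choose a' ha' using fun i ↦ (IsOpenImmersion.bijective_appLE U.ι
    (Scheme.Opens.opensRange_ι _).symm hUι).2 (a i)
  choose b' hb' using fun i ↦ (IsOpenImmersion.bijective_appLE V.ι
    (Scheme.Opens.opensRange_ι _).symm hVι).2 (b i)
  refine ⟨n, a', b', (IsOpenImmersion.bijective_appLE p hDp hp).1 ?_⟩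
  have h₁ : ⊤ ≤ (p ≫ fst) ⁻¹ᵁ U := fun x hx ↦ hDU (hp hx)
  have h₂ : ⊤ ≤ (p ≫ snd) ⁻¹ᵁ V := fun x hx ↦ hDV (hp hx)
  rw [← e, map_sum]
  refine Finset.sum_congr rfl fun i _ ↦ ?_
  rw [map_mul, Scheme.Hom.appLE_appLE_apply p fst rfl _ _ h₁,
    Scheme.Hom.appLE_appLE_apply p snd rfl _ _ h₂,
    ← Scheme.Hom.appLE_appLE_apply _ U.ι hpf.symm le_top hUι,
    ← Scheme.Hom.appLE_appLE_apply _ V.ι hps.symm le_top hVι, ha', hb',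
    show (pullback.fst f' g').appLE ⊤ ⊤ le_top = (pullback.fst f' g').appTop from
      Scheme.Hom.appLE_eq_app _,
    show (pullback.snd f' g').appLE ⊤ ⊤ le_top = (pullback.snd f' g').appTop from
      Scheme.Hom.appLE_eq_app _]

lemma Scheme.Hom.appLE_surjective {X Y : Scheme.{u}} (f : X ⟶ Y) [IsClosedImmersion f]
    {U : Y.Opens} (hU : IsAffineOpen U) {V : X.Opens} (hV : V = f ⁻¹ᵁ U) (e : V ≤ f ⁻¹ᵁ U) :
    Function.Surjective (f.appLE U V e) := by
  subst hV
  rw [Scheme.Hom.appLE_eq_app]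
  exact f.app_surjective U hU

lemma Scheme.Hom.appLE_surjective_congr {X Y : Scheme.{u}} (f : X ⟶ Y) {U U' : Y.Opens}
    {V V' : X.Opens} (hU : U = U') (hV : V = V') {e : V ≤ f ⁻¹ᵁ U}
    (h : Function.Surjective (f.appLE U V e)) (e' : V' ≤ f ⁻¹ᵁ U') :
    Function.Surjective (f.appLE U' V' e') := by
  subst hU hV
  exact h

/-- The subring of sections over `U ⊓ V` generated by the sections over `U` and over `V`. -/
def Scheme.subringInf (X : Scheme.{u}) (U V : X.Opens) : Subring Γ(X, U ⊓ V) :=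
  ((𝟙 X : X ⟶ X).appLE U (U ⊓ V) inf_le_left).hom.range ⊔
    ((𝟙 X : X ⟶ X).appLE V (U ⊓ V) inf_le_right).hom.range

variable {X Y : Scheme.{u}} (f : X ⟶ Y)

lemma exists_sum_of_isSeparated [IsSeparated f] {U V : X.Opens} {L : Y.Opens}
    (hU : IsAffineOpen U) (hV : IsAffineOpen V) (hL : IsAffineOpen L) (hUL : U ≤ f ⁻¹ᵁ L)
    (hVL : V ≤ f ⁻¹ᵁ L) (s : Γ(X, U ⊓ V)) :
    ∃ (n : ℕ) (a : Fin n → Γ(X, U)) (b : Fin n → Γ(X, V)),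
      ∑ i, (𝟙 X : X ⟶ X).appLE U (U ⊓ V) inf_le_left (a i) *
        (𝟙 X : X ⟶ X).appLE V (U ⊓ V) inf_le_right (b i) = s := by
  obtain ⟨hD, H⟩ := isAffineOpen_and_exists_sum_of_isPullback (.of_hasPullback f f) hU hV hL hUL
    hVL rfl inf_le_left inf_le_right
  have hΔ : pullback.diagonal f ⁻¹ᵁ (pullback.fst f f ⁻¹ᵁ U ⊓ pullback.snd f f ⁻¹ᵁ V) = U ⊓ V := by
    rw [Scheme.Hom.preimage_inf, ← Scheme.Hom.comp_preimage, ← Scheme.Hom.comp_preimage,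
      pullback.diagonal_fst, pullback.diagonal_snd, Scheme.Hom.id_preimage, Scheme.Hom.id_preimage]
  have hs := (pullback.diagonal f).appLE_surjective hD hΔ.symm hΔ.ge
  obtain ⟨t, rfl⟩ := hs s
  obtain ⟨n, a, b, rfl⟩ := H t
  refine ⟨n, a, b, ?_⟩
  rw [map_sum]
  refine Finset.sum_congr rfl fun i _ ↦ ?_
  have h₁ : U ⊓ V ≤ (𝟙 X : X ⟶ X) ⁻¹ᵁ U := inf_le_left
  have h₂ : U ⊓ V ≤ (𝟙 X : X ⟶ X) ⁻¹ᵁ V := inf_le_right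
  rw [map_mul, Scheme.Hom.appLE_appLE_apply _ _ (pullback.diagonal_fst f) _ _ h₁,
    Scheme.Hom.appLE_appLE_apply _ _ (pullback.diagonal_snd f) _ _ h₂]

/-- A morphism with affine diagonal is separated if sections over intersections are generated by
sections on the pieces. -/
lemma isSeparated_of_subringInf_eq_top [IsAffineHom (pullback.diagonal f)]
    (H : ∀ x₁ x₂, f x₁ = f x₂ → ∃ (L : Y.Opens) (U V : X.Opens), IsAffineOpen L ∧ IsAffineOpen U ∧
      IsAffineOpen V ∧ U ≤ f ⁻¹ᵁ L ∧ V ≤ f ⁻¹ᵁ L ∧ x₁ ∈ U ∧ x₂ ∈ V ∧ X.subringInf U V = ⊤) :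
    IsSeparated f := by
  have H' (z : ↑(pullback f f)) : ∃ (U V : X.Opens) (D : (pullback f f).Opens), z ∈ D ∧
      D = pullback.fst f f ⁻¹ᵁ U ⊓ pullback.snd f f ⁻¹ᵁ V ∧ IsAffineOpen D ∧
      X.subringInf U V = ⊤ := by
    obtain ⟨L, U, V, hL, hU, hV, hUL, hVL, h₁, h₂, h⟩ :=
      H (pullback.fst f f z) (pullback.snd f f z) (by
        rw [← Scheme.Hom.comp_apply, pullback.condition, Scheme.Hom.comp_apply])
    exact ⟨U, V, pullback.fst f f ⁻¹ᵁ U ⊓ pullback.snd f f ⁻¹ᵁ V, ⟨h₁, h₂⟩, rfl, (isAffineOpen_and_exists_sum_of_isPullback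
      (.of_hasPullback f f) hU hV hL hUL hVL rfl inf_le_left inf_le_right).1, h⟩
  choose U V D hzD hD hDa hUV using H'
  refine ⟨IsZariskiLocalAtTarget.of_iSup_eq_top D
    (eq_top_iff.mpr fun z _ ↦ Opens.mem_iSup.mpr ⟨z, hzD z⟩) fun z ↦ ?_⟩
  have : IsAffine (D z) := hDa z
  have : IsAffine (pullback.diagonal f ⁻¹ᵁ D z) := (hDa z).preimage _
  refine IsClosedImmersion.of_surjective_of_isAffine _ ?_
  have hΔ : pullback.diagonal f ⁻¹ᵁ D z = U z ⊓ V z := by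
    rw [hD, Scheme.Hom.preimage_inf, ← Scheme.Hom.comp_preimage, ← Scheme.Hom.comp_preimage,
      pullback.diagonal_fst, pullback.diagonal_snd, Scheme.Hom.id_preimage, Scheme.Hom.id_preimage]
  have hDU : D z ≤ pullback.fst f f ⁻¹ᵁ U z := hD z ▸ inf_le_left
  have hDV : D z ≤ pullback.snd f f ⁻¹ᵁ V z := hD z ▸ inf_le_right
  have h₁ : U z ⊓ V z ≤ (𝟙 X : X ⟶ X) ⁻¹ᵁ U z := inf_le_left
  have h₂ : U z ⊓ V z ≤ (𝟙 X : X ⟶ X) ⁻¹ᵁ V z := inf_le_right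
  have hs : Function.Surjective ((pullback.diagonal f).appLE (D z) (U z ⊓ V z) hΔ.ge) := by
    rw [← RingHom.range_eq_top, eq_top_iff, ← hUV z]
    refine sup_le ?_ ?_
    · rintro _ ⟨t, rfl⟩
      exact ⟨(pullback.fst f f).appLE _ _ hDU t,
        Scheme.Hom.appLE_appLE_apply _ _ (pullback.diagonal_fst f) _ _ h₁ t⟩
    · rintro _ ⟨t, rfl⟩
      exact ⟨(pullback.snd f f).appLE _ _ hDV t,
        Scheme.Hom.appLE_appLE_apply _ _ (pullback.diagonal_snd f) _ _ h₂ t⟩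
  rw [Scheme.Hom.appTop, morphismRestrict_app']
  refine Scheme.Hom.appLE_surjective_congr _ ?_ ?_ hs _
  · rw [Scheme.Hom.image_top_eq_opensRange, Scheme.Opens.opensRange_ι]
  · rw [Scheme.Hom.preimage_top, Scheme.Hom.image_top_eq_opensRange, Scheme.Opens.opensRange_ι, hΔ]

end AlgebraicGeometry

namespace AlgebraicGeometry

variable {X T T' W Y : Scheme.{u}}

lemma exists_sum_of_isAffineHom (q : T' ⟶ T) [IsAffineHom q] {U V : T.Opens} (hU : IsAffineOpen U)
    (hUV : IsAffineOpen (U ⊓ V)) (s : Γ(T', q ⁻¹ᵁ U ⊓ q ⁻¹ᵁ V)) :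
    ∃ (n : ℕ) (a : Fin n → Γ(T', q ⁻¹ᵁ U)) (b : Fin n → Γ(T, U ⊓ V)),
      ∑ i, (𝟙 T' : T' ⟶ T').appLE (q ⁻¹ᵁ U) (q ⁻¹ᵁ U ⊓ q ⁻¹ᵁ V) inf_le_left (a i) *
        q.appLE (U ⊓ V) (q ⁻¹ᵁ U ⊓ q ⁻¹ᵁ V) le_rfl (b i) = s := by
  have H : IsPullback (𝟙 T') q q (𝟙 T) := .of_horiz_isIso ⟨by simp⟩
  have h₁ : q ⁻¹ᵁ U ≤ q ⁻¹ᵁ U := le_rfl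
  have h₂ : U ⊓ V ≤ (𝟙 T : T ⟶ T) ⁻¹ᵁ U := inf_le_left
  have hD : q ⁻¹ᵁ U ⊓ q ⁻¹ᵁ V = (𝟙 T' : T' ⟶ T') ⁻¹ᵁ q ⁻¹ᵁ U ⊓ q ⁻¹ᵁ (U ⊓ V) := by
    rw [Scheme.Hom.id_preimage, Scheme.Hom.preimage_inf, ← inf_assoc, inf_idem]
  exact (isAffineOpen_and_exists_sum_of_isPullback H (hU.preimage q) hUV hU h₁ h₂ hD _ _).2 s

lemma map_subringInf_le (q : T' ⟶ T) (U V : T.Opens) (e : q ⁻¹ᵁ U ⊓ q ⁻¹ᵁ V ≤ q ⁻¹ᵁ (U ⊓ V)) :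
    (T.subringInf U V).map (q.appLE (U ⊓ V) (q ⁻¹ᵁ U ⊓ q ⁻¹ᵁ V) e).hom ≤
      T'.subringInf (q ⁻¹ᵁ U) (q ⁻¹ᵁ V) := by
  have e₁ : U ⊓ V ≤ (𝟙 T : T ⟶ T) ⁻¹ᵁ U := inf_le_left
  have e₂ : U ⊓ V ≤ (𝟙 T : T ⟶ T) ⁻¹ᵁ V := inf_le_right
  have e₁' : q ⁻¹ᵁ U ⊓ q ⁻¹ᵁ V ≤ (𝟙 T' : T' ⟶ T') ⁻¹ᵁ (q ⁻¹ᵁ U) := inf_le_left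
  have e₂' : q ⁻¹ᵁ U ⊓ q ⁻¹ᵁ V ≤ (𝟙 T' : T' ⟶ T') ⁻¹ᵁ (q ⁻¹ᵁ V) := inf_le_right
  have h₁ : q ⁻¹ᵁ U ≤ q ⁻¹ᵁ U := le_rfl
  have h₂ : q ⁻¹ᵁ V ≤ q ⁻¹ᵁ V := le_rfl
  have l₁ : q ⁻¹ᵁ U ⊓ q ⁻¹ᵁ V ≤ q ⁻¹ᵁ U := inf_le_left
  have l₂ : q ⁻¹ᵁ U ⊓ q ⁻¹ᵁ V ≤ q ⁻¹ᵁ V := inf_le_right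
  rw [Subring.map_le_iff_le_comap]
  refine sup_le ?_ ?_
  · rintro _ ⟨t, rfl⟩
    refine le_sup_left (α := Subring _) ⟨q.appLE U (q ⁻¹ᵁ U) h₁ t, ?_⟩
    exact (Scheme.Hom.appLE_appLE_apply _ _ (Category.id_comp q) e₁' h₁ l₁ t).trans
      (Scheme.Hom.appLE_appLE_apply _ _ (Category.comp_id q) e e₁ l₁ t).symm
  · rintro _ ⟨t, rfl⟩
    refine le_sup_right (α := Subring _) ⟨q.appLE V (q ⁻¹ᵁ V) h₂ t, ?_⟩
    exact (Scheme.Hom.appLE_appLE_apply _ _ (Category.id_comp q) e₂' h₂ l₂ t).trans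
      (Scheme.Hom.appLE_appLE_apply _ _ (Category.comp_id q) e e₂ l₂ t).symm

lemma subringInf_eq_top_of_forall_mem (q : T' ⟶ T) [IsAffineHom q] {U V : T.Opens}
    (hU : IsAffineOpen U) (hUV : IsAffineOpen (U ⊓ V))
    (e : q ⁻¹ᵁ U ⊓ q ⁻¹ᵁ V ≤ q ⁻¹ᵁ (U ⊓ V))
    (H : ∀ s, q.appLE (U ⊓ V) (q ⁻¹ᵁ U ⊓ q ⁻¹ᵁ V) e s ∈ T'.subringInf (q ⁻¹ᵁ U) (q ⁻¹ᵁ V)) :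
    T'.subringInf (q ⁻¹ᵁ U) (q ⁻¹ᵁ V) = ⊤ := by
  refine eq_top_iff.mpr fun s _ ↦ ?_
  obtain ⟨n, a, b, rfl⟩ := exists_sum_of_isAffineHom q hU hUV s
  exact sum_mem fun i _ ↦ mul_mem (le_sup_left (α := Subring _) ⟨a i, rfl⟩) (H (b i))

lemma subringInf_preimage_eq_top (q : T' ⟶ T) [IsAffineHom q] {U V : T.Opens}
    (hU : IsAffineOpen U) (hUV : IsAffineOpen (U ⊓ V)) (H : T.subringInf U V = ⊤) :
    T'.subringInf (q ⁻¹ᵁ U) (q ⁻¹ᵁ V) = ⊤ :=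
  subringInf_eq_top_of_forall_mem q hU hUV le_rfl fun s ↦
    map_subringInf_le q U V le_rfl ⟨s, H ▸ Subring.mem_top s, rfl⟩

/-- If `X` is separated over `Y`, then sections over an intersection of affine opens are generated
by sections on the pieces over some finite type affine model of `X`. -/
lemma exists_subringInf_eq_top [CompactSpace W] [QuasiSeparatedSpace W] (g : X ⟶ W) (h : W ⟶ Y)
    [IsAffineHom g] [IsSeparated (g ≫ h)] {L : Y.Opens} {U V : W.Opens}
    (hL : IsAffineOpen L) (hU : IsAffineOpen U) (hV : IsAffineOpen V) (hUV : IsAffineOpen (U ⊓ V))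
    (hUL : U ≤ h ⁻¹ᵁ L) (hVL : V ≤ h ⁻¹ᵁ L) :
    ∃ (T : Scheme.{u}) (a : X ⟶ T) (p : T ⟶ W), IsAffineModel a p ∧ a ≫ p = g ∧
      T.subringInf (p ⁻¹ᵁ U) (p ⁻¹ᵁ V) = ⊤ := by
  have e₁ : U ⊓ V ≤ (𝟙 W : W ⟶ W) ⁻¹ᵁ U := inf_le_left
  obtain ⟨S, hS⟩ := (𝟙 W : W ⟶ W).finiteType_appLE hU hUV e₁
  have eg : g ⁻¹ᵁ U ⊓ g ⁻¹ᵁ V ≤ g ⁻¹ᵁ (U ⊓ V) := le_rfl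
  have hgU : g ⁻¹ᵁ U ≤ (g ≫ h) ⁻¹ᵁ L := fun x hx ↦ hUL hx
  have hgV : g ⁻¹ᵁ V ≤ (g ≫ h) ⁻¹ᵁ L := fun x hx ↦ hVL hx
  choose n a b hab using fun ν : S ↦ exists_sum_of_isSeparated (g ≫ h) (hU.preimage g)
    (hV.preimage g) hL hgU hgV (g.appLE (U ⊓ V) _ eg ν.1)
  obtain ⟨T, f, p, hp, rfl, H⟩ := exists_forall_appLE_eq g
    (ι := (Σ ν : S, Fin (n ν)) ⊕ (Σ ν : S, Fin (n ν)))
    (Sum.elim (fun _ ↦ U) (fun _ ↦ V)) (by rintro (_ | _); exacts [hU.isCompact, hV.isCompact])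
    (Sum.elim (fun _ ↦ g ⁻¹ᵁ U) (fun _ ↦ g ⁻¹ᵁ V)) (by rintro (_ | _) <;> rfl)
    (Sum.rec (fun i ↦ a i.1 i.2) (fun i ↦ b i.1 i.2))
  have ea : (f ≫ p) ⁻¹ᵁ U ≤ f ⁻¹ᵁ p ⁻¹ᵁ U := le_rfl
  have eb : (f ≫ p) ⁻¹ᵁ V ≤ f ⁻¹ᵁ p ⁻¹ᵁ V := le_rfl
  have Ha (ν i) : ∃ t : Γ(T, p ⁻¹ᵁ U), f.appLE _ _ ea t = a ν i := (H (.inl ⟨ν, i⟩)).2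
  have Hb (ν i) : ∃ t : Γ(T, p ⁻¹ᵁ V), f.appLE _ _ eb t = b ν i := (H (.inr ⟨ν, i⟩)).2
  choose a' ha' using Ha
  choose b' hb' using Hb
  obtain ⟨_, _, _, _⟩ := id hp
  have ep : p ⁻¹ᵁ U ⊓ p ⁻¹ᵁ V ≤ p ⁻¹ᵁ (U ⊓ V) := le_rfl
  refine ⟨T, f, p, hp, rfl, subringInf_eq_top_of_forall_mem p hU hUV ep fun s ↦ ?_⟩
  algebraize [((𝟙 W : W ⟶ W).appLE U (U ⊓ V) e₁).hom]
  have hs : s ∈ Algebra.adjoin Γ(W, U) (S : Set Γ(W, U ⊓ V)) := hS ▸ Algebra.mem_top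
  have ef : (f ≫ p) ⁻¹ᵁ U ⊓ (f ≫ p) ⁻¹ᵁ V ≤ f ⁻¹ᵁ (p ⁻¹ᵁ U ⊓ p ⁻¹ᵁ V) := le_rfl
  have l₁ : p ⁻¹ᵁ U ⊓ p ⁻¹ᵁ V ≤ (𝟙 T : T ⟶ T) ⁻¹ᵁ p ⁻¹ᵁ U := inf_le_left
  have l₂ : p ⁻¹ᵁ U ⊓ p ⁻¹ᵁ V ≤ (𝟙 T : T ⟶ T) ⁻¹ᵁ p ⁻¹ᵁ V := inf_le_right
  have m₁ : (f ≫ p) ⁻¹ᵁ U ⊓ (f ≫ p) ⁻¹ᵁ V ≤ f ⁻¹ᵁ p ⁻¹ᵁ U := inf_le_left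
  have m₂ : (f ≫ p) ⁻¹ᵁ U ⊓ (f ≫ p) ⁻¹ᵁ V ≤ f ⁻¹ᵁ p ⁻¹ᵁ V := inf_le_right
  have m₁' : (f ≫ p) ⁻¹ᵁ U ⊓ (f ≫ p) ⁻¹ᵁ V ≤ (𝟙 X : X ⟶ X) ⁻¹ᵁ ((f ≫ p) ⁻¹ᵁ U) := inf_le_left
  have m₂' : (f ≫ p) ⁻¹ᵁ U ⊓ (f ≫ p) ⁻¹ᵁ V ≤ (𝟙 X : X ⟶ X) ⁻¹ᵁ ((f ≫ p) ⁻¹ᵁ V) := inf_le_right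
  induction hs using Algebra.adjoin_induction with
  | mem ν hν =>
    suffices p.appLE (U ⊓ V) (p ⁻¹ᵁ U ⊓ p ⁻¹ᵁ V) ep ν = ∑ i,
        (𝟙 T : T ⟶ T).appLE _ _ l₁ (a' ⟨ν, hν⟩ i) * (𝟙 T : T ⟶ T).appLE _ _ l₂ (b' ⟨ν, hν⟩ i) by
      rw [this]
      exact sum_mem fun i _ ↦ mul_mem (le_sup_left (α := Subring _) ⟨a' ⟨ν, hν⟩ i, rfl⟩)
        (le_sup_right (α := Subring _) ⟨b' ⟨ν, hν⟩ i, rfl⟩)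
    apply hp.appLE_injective ef rfl
    rw [Scheme.Hom.appLE_appLE_apply f p rfl _ _ eg, ← hab ⟨ν, hν⟩, map_sum]
    refine Finset.sum_congr rfl fun i _ ↦ ?_
    rw [map_mul, Scheme.Hom.appLE_appLE_apply f _ (Category.comp_id f) _ _ m₁,
      Scheme.Hom.appLE_appLE_apply f _ (Category.comp_id f) _ _ m₂, ← ha', ← hb',
      Scheme.Hom.appLE_appLE_apply _ f (Category.id_comp f) m₁' _ m₁,
      Scheme.Hom.appLE_appLE_apply _ f (Category.id_comp f) m₂' _ m₂]
  | algebraMap r =>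
    exact map_subringInf_le p U V ep ⟨_, le_sup_left (α := Subring _) ⟨r, rfl⟩, rfl⟩
  | add x y _ _ hx hy => rw [map_add]; exact add_mem hx hy
  | mul x y _ _ hx hy => rw [map_mul]; exact mul_mem hx hy

end AlgebraicGeometry

namespace AlgebraicGeometry

variable {X T T' W Y : Scheme.{u}}

lemma isAffineHom_pullback_map (p : T ⟶ W) (h : W ⟶ Y) [IsAffineHom p] :
    IsAffineHom (pullback.map (p ≫ h) (p ≫ h) h h p p (𝟙 Y)
      (Category.comp_id _) (Category.comp_id _)) := by
  have : MorphismProperty.IsStableUnderComposition @IsAffineHom :=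
    ⟨fun _ _ _ _ ↦ inferInstance⟩
  exact MorphismProperty.pullbackMap (P := @IsAffineHom) ‹_› ‹_› rfl rfl

lemma diagonal_comp_pullback_map (p : T ⟶ W) (h : W ⟶ Y) :
    pullback.diagonal (p ≫ h) ≫ pullback.map (p ≫ h) (p ≫ h) h h p p (𝟙 Y)
      (Category.comp_id _) (Category.comp_id _) = p ≫ pullback.diagonal h := by
  refine pullback.hom_ext ?_ ?_
  · rw [Category.assoc, Category.assoc, pullback.diagonal_fst, Category.comp_id]
    refine (congrArg _ (pullback.lift_fst _ _ _)).trans ?_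
    rw [pullback.diagonal_fst_assoc]
  · rw [Category.assoc, Category.assoc, pullback.diagonal_snd, Category.comp_id]
    refine (congrArg _ (pullback.lift_snd _ _ _)).trans ?_
    rw [pullback.diagonal_snd_assoc]

lemma isAffineHom_diagonal_comp_iff (p : T ⟶ W) (h : W ⟶ Y) [IsAffineHom p] :
    IsAffineHom (pullback.diagonal (p ≫ h)) ↔ IsAffineHom (p ≫ pullback.diagonal h) := by
  have := isAffineHom_pullback_map p h
  rw [← diagonal_comp_pullback_map, IsAffineHom.comp_iff]

/-- A finite type affine model can be chosen to have affine diagonal over `Y` if `X` is separated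
over `Y`. -/
lemma exists_isAffineHom_diagonal [CompactSpace W] [QuasiSeparatedSpace W]
    [QuasiSeparatedSpace Y] (g : X ⟶ W) (h : W ⟶ Y) [IsAffineHom g] [IsSeparated (g ≫ h)] :
    ∃ (T : Scheme.{u}) (a : X ⟶ T) (p : T ⟶ W), IsAffineModel a p ∧ a ≫ p = g ∧
      IsAffineHom (pullback.diagonal (p ≫ h)) := by
  have : QuasiSeparatedSpace ↑(pullback h h) :=
    quasiSeparatedSpace_of_quasiSeparated (pullback.snd h h)
  have : IsAffineHom (g ≫ pullback.diagonal h) :=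
    (isAffineHom_diagonal_comp_iff g h).mp inferInstance
  obtain ⟨T, a, p, hp, e, H⟩ := exists_isAffineHom_comp g (pullback.diagonal h)
  have := hp.isAffineHom_right
  exact ⟨T, a, p, hp, e, (isAffineHom_diagonal_comp_iff p h).mpr H⟩

/-- The fibre square of a morphism is covered by finitely many products of affine opens. -/
lemma exists_finite_affine_cover_pullback (h : W ⟶ Y) [CompactSpace ↑(pullback h h)] :
    ∃ (ι : Type u) (_ : Finite ι) (L : ι → Y.Opens) (U V : ι → W.Opens),
      (∀ i, IsAffineOpen (L i)) ∧ (∀ i, IsAffineOpen (U i)) ∧ (∀ i, IsAffineOpen (V i)) ∧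
      (∀ i, U i ≤ h ⁻¹ᵁ L i) ∧ (∀ i, V i ≤ h ⁻¹ᵁ L i) ∧
      ∀ w₁ w₂, h w₁ = h w₂ → ∃ i, w₁ ∈ U i ∧ w₂ ∈ V i := by
  have H (z : ↑(pullback h h)) : ∃ (L : Y.Opens) (U V : W.Opens), IsAffineOpen L ∧
      IsAffineOpen U ∧ IsAffineOpen V ∧ U ≤ h ⁻¹ᵁ L ∧ V ≤ h ⁻¹ᵁ L ∧
      z ∈ pullback.fst h h ⁻¹ᵁ U ⊓ pullback.snd h h ⁻¹ᵁ V := by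
    have e : h (pullback.fst h h z) = h (pullback.snd h h z) := by
      rw [← Scheme.Hom.comp_apply, pullback.condition, Scheme.Hom.comp_apply]
    obtain ⟨L, hL, hzL, -⟩ := exists_isAffineOpen_mem_and_subset
      (Opens.mem_top (h (pullback.fst h h z)))
    obtain ⟨U, hU, hzU, hUL⟩ := exists_isAffineOpen_mem_and_subset (U := h ⁻¹ᵁ L) hzL
    obtain ⟨V, hV, hzV, hVL⟩ := exists_isAffineOpen_mem_and_subset (U := h ⁻¹ᵁ L)
      (x := pullback.snd h h z) (by rw [e] at hzL; exact hzL)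
    exact ⟨L, U, V, hL, hU, hV, hUL, hVL, hzU, hzV⟩
  choose L U V hL hU hV hUL hVL hz using H
  obtain ⟨t, ht⟩ := isCompact_univ.elim_finite_subcover
    (fun z ↦ ((pullback.fst h h ⁻¹ᵁ U z ⊓ pullback.snd h h ⁻¹ᵁ V z : (pullback h h).Opens) :
      Set ↑(pullback h h))) (fun z ↦ Opens.isOpen _) fun z _ ↦ Set.mem_iUnion.mpr ⟨z, hz z⟩
  refine ⟨t, inferInstance, fun z ↦ L z, fun z ↦ U z, fun z ↦ V z, fun z ↦ hL z, fun z ↦ hU z,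
    fun z ↦ hV z, fun z ↦ hUL z, fun z ↦ hVL z, fun w₁ w₂ e ↦ ?_⟩
  obtain ⟨z, rfl, rfl⟩ := Scheme.Pullback.exists_preimage_pullback w₁ w₂ e
  obtain ⟨i, hi, hi'⟩ := Set.mem_iUnion₂.mp (ht (Set.mem_univ z))
  exact ⟨⟨i, hi⟩, hi'⟩

lemma subringInf_eq_top_congr {U U' V V' : X.Opens} (hU : U = U') (hV : V = V')
    (h : X.subringInf U V = ⊤) : X.subringInf U' V' = ⊤ := by
  subst hU hV
  exact h

/-- A finite type affine model can be chosen to be separated over `Y` if `X` is separated over `Y`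
and `W` has affine diagonal over `Y`. -/
lemma exists_isSeparated_comp_of_isAffineHom_diagonal [CompactSpace W] [QuasiSeparatedSpace W]
    [QuasiSeparatedSpace Y] (g : X ⟶ W) (h : W ⟶ Y) [IsAffineHom g] [hgh : IsSeparated (g ≫ h)]
    [hd : IsAffineHom (pullback.diagonal h)] :
    ∃ (T : Scheme.{u}) (a : X ⟶ T) (p : T ⟶ W), IsAffineModel a p ∧ a ≫ p = g ∧
      IsSeparated (p ≫ h) := by
  obtain ⟨ι, _, L, U, V, hL, hU, hV, hUL, hVL, H⟩ := exists_finite_affine_cover_pullback h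
  have hUV (i) : IsAffineOpen (U i ⊓ V i) :=
    isAffineHom_diagonal_iff.mp hd _ (hL i) _ (hUL i) _ (hVL i) (hU i) (hV i)
  have hP := exists_isAffineModel_forall g
    (fun i T _ p ↦ IsAffineHom p ∧ T.subringInf (p ⁻¹ᵁ U i) (p ⁻¹ᵁ V i) = ⊤)
    (fun i T T' a p b q hq _ _ hp ↦ by
      have := hp.1
      exact ⟨inferInstance, subringInf_eq_top_congr (Scheme.Hom.comp_preimage q p _).symm
        (Scheme.Hom.comp_preimage q p _).symm
        (subringInf_preimage_eq_top q ((hU i).preimage p) ((hUV i).preimage p) hp.2)⟩)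
    fun i T a p hp e ↦ by
      have := hp.compactSpace
      have := hp.quasiSeparatedSpace
      obtain ⟨_, _, _, _⟩ := id hp
      have : IsSeparated (a ≫ p ≫ h) := by rwa [← Category.assoc, e]
      have hpU : p ⁻¹ᵁ U i ≤ (p ≫ h) ⁻¹ᵁ L i := fun x hx ↦ hUL i hx
      have hpV : p ⁻¹ᵁ V i ≤ (p ≫ h) ⁻¹ᵁ L i := fun x hx ↦ hVL i hx
      obtain ⟨T', b, q, hq, e', H'⟩ := exists_subringInf_eq_top a (p ≫ h) (hL i)
        ((hU i).preimage p) ((hV i).preimage p) ((hUV i).preimage p) hpU hpV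
      have := hq.isAffineHom_right
      exact ⟨T', b, q, hq, e', inferInstance, subringInf_eq_top_congr
        (Scheme.Hom.comp_preimage q p _).symm (Scheme.Hom.comp_preimage q p _).symm H'⟩
  obtain ⟨T, a, p, hp, rfl, HT⟩ := hP
  refine ⟨T, a, p, hp, rfl, ?_⟩
  have := hp.isAffineHom_right
  have : IsAffineHom (pullback.diagonal (p ≫ h)) :=
    (isAffineHom_diagonal_comp_iff p h).mpr inferInstance
  refine isSeparated_of_subringInf_eq_top _ fun x₁ x₂ e ↦ ?_
  obtain ⟨i, h₁, h₂⟩ := H (p x₁) (p x₂) (by simpa using e)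
  exact ⟨L i, p ⁻¹ᵁ U i, p ⁻¹ᵁ V i, hL i, (hU i).preimage p, (hV i).preimage p,
    fun x hx ↦ hUL i hx, fun x hx ↦ hVL i hx, h₁, h₂, (HT i).2⟩

/-- A finite type affine model can be chosen to be separated over `Y` if `X` is separated
over `Y`. -/
theorem exists_isSeparated_comp [CompactSpace W] [QuasiSeparatedSpace W] [QuasiSeparatedSpace Y]
    (g : X ⟶ W) (h : W ⟶ Y) [IsAffineHom g] [hgh : IsSeparated (g ≫ h)] :
    ∃ (T : Scheme.{u}) (a : X ⟶ T) (p : T ⟶ W), IsAffineModel a p ∧ a ≫ p = g ∧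
      IsSeparated (p ≫ h) := by
  obtain ⟨T, a, p, hp, rfl, _⟩ := exists_isAffineHom_diagonal g h
  have := hp.compactSpace
  have := hp.quasiSeparatedSpace
  have := hp.isAffineHom_left
  have : IsSeparated (a ≫ p ≫ h) := by rwa [← Category.assoc]
  obtain ⟨T', b, q, hq, rfl, H⟩ := exists_isSeparated_comp_of_isAffineHom_diagonal a (p ≫ h)
  exact ⟨T', b, q ≫ p, hp.comp hq, (Category.assoc _ _ _).symm, by rwa [Category.assoc]⟩

end AlgebraicGeometry

/-- Temkin's decomposition: a separated universally closed morphism of qcqs schemes factors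
as an integral morphism followed by a proper morphism. -/
theorem exists_integral_proper_factorisation {X Y : Scheme} (f : X ⟶ Y)
    [CompactSpace X] [QuasiSeparatedSpace X] [CompactSpace Y] [QuasiSeparatedSpace Y]
    [IsSeparated f] [UniversallyClosed f] :
    ∃ (Z : Scheme) (g : X ⟶ Z) (h : Z ⟶ Y),
      IsIntegralHom g ∧ IsProper h ∧ g ≫ h = f := by
  obtain ⟨W, g, k, _, _, _, _, rfl⟩ := exists_isAffineHom_comp_locallyOfFiniteType f
  obtain ⟨Z, a, p, ⟨_, _, _, _⟩, rfl, hs⟩ := exists_isSeparated_comp g k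
  have : UniversallyClosed (a ≫ p ≫ k) := by rwa [← Category.assoc]
  have : UniversallyClosed a := .of_comp_of_isSeparated a (p ≫ k)
  have : Surjective a :=
    surjective_of_isDominant_of_isClosed_range a a.isClosedMap.isClosed_range
  have : UniversallyClosed (p ≫ k) := .of_comp_surjective a (p ≫ k)
  exact ⟨Z, a, p ≫ k, IsIntegralHom.iff_universallyClosed_and_isAffineHom.mpr ⟨‹_›, ‹_›⟩, { },
    (Category.assoc _ _ _).symm⟩
end

section
/- Let R be a commutative ring, A an R-algebra of finite expansion, and B an A-algebra such that the three algebra structures are compatible (IsScalarTower R A B). Then B is of finite expansion over R if and only if B is of finite expansion over A. -/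
/-- Integrality over a subalgebra passes along a ring homomorphism that maps it into another
subalgebra. -/
theorem IsIntegral.map_of_mapsTo {R S A B : Type*} [CommRing R] [CommRing S] [CommRing A]
    [CommRing B] [Algebra R A] [Algebra S B] {C : Subalgebra R A} {D : Subalgebra S B}
    (f : A →+* B) (h : ∀ x ∈ C, f x ∈ D) {a : A} (ha : IsIntegral C a) :
    IsIntegral D (f a) :=
  ha.map_of_comp_eq ((f.comp C.val.toRingHom).codRestrict D fun x ↦ h x x.2) f rfl

/-- If `A` is of finite expansion over `R`, then an `A`-algebra `B` is of finite expansion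
over `R` if and only if it is of finite expansion over `A`. -/
theorem Algebra.FiniteExpansion.iff_of_tower (R A B : Type*) [CommRing R] [CommRing A]
    [CommRing B] [Algebra R A] [Algebra A B] [Algebra R B] [IsScalarTower R A B]
    (hA : Algebra.FiniteExpansion R A) :
    Algebra.FiniteExpansion R B ↔ Algebra.FiniteExpansion A B := by
  classical
  obtain ⟨s, hs⟩ := hA
  constructor
  · rintro ⟨t, ht⟩
    refine ⟨t, ⟨fun b ↦ (ht.isIntegral b).map_of_mapsTo (RingHom.id B) fun x hx ↦ ?_⟩⟩
    have hle : Algebra.adjoin R (t : Set B) ≤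
        (Algebra.adjoin A (t : Set B)).restrictScalars R :=
      Algebra.adjoin_le Algebra.subset_adjoin
    exact hle hx
  · rintro ⟨t, ht⟩
    refine ⟨s.image (algebraMap A B) ∪ t, ⟨fun b ↦ ?_⟩⟩
    set C := Algebra.adjoin R ((s.image (algebraMap A B) ∪ t : Finset B) : Set B)
    have hsC : Algebra.adjoin R (s : Set A) ≤ C.comap (IsScalarTower.toAlgHom R A B) :=
      Algebra.adjoin_le fun x hx ↦ Algebra.subset_adjoin <| by
        simpa using Or.inl ⟨x, hx, rfl⟩
    have hA (a : A) : IsIntegral C (algebraMap A B a) :=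
      (hs.isIntegral a).map_of_mapsTo (algebraMap A B) hsC
    have htC : ∀ x ∈ Algebra.adjoin A (t : Set B), x ∈ integralClosure C B := by
      intro x hx
      induction hx using Algebra.adjoin_induction with
      | mem x hx =>
        have hxC : x ∈ C := Algebra.subset_adjoin <| by simpa using Or.inr hx
        exact isIntegral_algebraMap (x := (⟨x, hxC⟩ : C))
      | algebraMap a => exact hA a
      | add x y _ _ hx hy => exact add_mem hx hy
      | mul x y _ _ hx hy => exact mul_mem hx hy
    exact isIntegral_trans (A := integralClosure C B) b <|
      (ht.isIntegral b).map_of_mapsTo (RingHom.id B) htC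
end
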